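/- arXiv:2510.06398 — 4 statements merged into one kernel-verified Lean document; each statement's English description precedes it below -/
import Mathlib

section
/- Let 𝒳 be a fundamental minimal system for 𝕏 and K ≥ 1. Then the linear span ⟨𝒳*⟩ of the dual system is a K⁻¹-norming subspace of 𝕏* if and only if for each ε > 0 and each finite-dimensional subspace 𝕍 ⊆ 𝕏 there is m(𝕍,ε) ∈ ℕ such that ‖f‖ ≤ (K + ε)‖f + g‖ for every f ∈ 𝕍 and every g in the closed linear span of 𝒳_{>m(𝕍,ε)}. -/
/-- Every functional in the span of the dual system kills a tail of the system. -/
theorem exists_tail_vanish {𝕜 : Type*} [RCLike 𝕜] {X : Type*} [NormedAddCommGroup X]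
    [NormedSpace 𝕜 X] (x : ℕ → X) (xs : ℕ → X →L[𝕜] 𝕜)
    (hbi : ∀ n k, xs n (x k) = if n = k then 1 else 0)
    (φ : X →L[𝕜] 𝕜) (hφ : φ ∈ Submodule.span 𝕜 (Set.range xs)) :
    ∃ m : ℕ, ∀ n, m < n → φ (x n) = 0 := by
  induction hφ using Submodule.span_induction with
  | mem y hy =>
    obtain ⟨k, rfl⟩ := hy
    refine ⟨k, fun n hn => ?_⟩
    rw [hbi, if_neg (by omega)]
  | zero => exact ⟨0, fun n _ => by simp⟩
  | add y z _ _ h1 h2 =>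
    obtain ⟨a, ha⟩ := h1
    obtain ⟨b, hb⟩ := h2
    refine ⟨max a b, fun n hn => ?_⟩
    rw [ContinuousLinearMap.add_apply, ha n (by omega), hb n (by omega), add_zero]
  | smul c y _ h =>
    obtain ⟨a, ha⟩ := h
    exact ⟨a, fun n hn => by simp [ha n hn]⟩

/-- A functional killing the tail vectors kills the closed span of the tail. -/
theorem vanish_on_closure {𝕜 : Type*} [RCLike 𝕜] {X : Type*} [NormedAddCommGroup X]
    [NormedSpace 𝕜 X] (x : ℕ → X) (φ : X →L[𝕜] 𝕜) (m : ℕ)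
    (h : ∀ n, m < n → φ (x n) = 0) (g : X)
    (hg : g ∈ (Submodule.span 𝕜 (x '' {n | m < n})).topologicalClosure) : φ g = 0 := by
  have hle : (Submodule.span 𝕜 (x '' {n | m < n})).topologicalClosure ≤
      LinearMap.ker (φ : X →ₗ[𝕜] 𝕜) := by
    apply Submodule.topologicalClosure_minimal
    · rw [Submodule.span_le]
      rintro _ ⟨n, hn, rfl⟩
      exact h n hn
    · exact φ.isClosed_ker
  exact hle hg

/-- A functional killing a tail lies in the span of the dual system. -/
theorem mem_span_of_tail {𝕜 : Type*} [RCLike 𝕜] {X : Type*} [NormedAddCommGroup X]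
    [NormedSpace 𝕜 X] (x : ℕ → X) (xs : ℕ → X →L[𝕜] 𝕜)
    (hdense : Dense (Submodule.span 𝕜 (Set.range x) : Set X))
    (hbi : ∀ n k, xs n (x k) = if n = k then 1 else 0)
    (φ : X →L[𝕜] 𝕜) (m : ℕ) (h : ∀ n, m < n → φ (x n) = 0) :
    φ ∈ Submodule.span 𝕜 (Set.range xs) := by
  have : φ = ∑ n ∈ Finset.range (m + 1), φ (x n) • xs n := by
    apply ContinuousLinearMap.ext_on hdense
    rintro _ ⟨k, rfl⟩
    rw [ContinuousLinearMap.sum_apply]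
    simp only [ContinuousLinearMap.smul_apply, hbi, smul_eq_mul, mul_ite, mul_one, mul_zero,
      Finset.sum_ite_eq', Finset.mem_range]
    split_ifs with hk
    · rfl
    · exact h k (by omega)
  rw [this]
  exact Submodule.sum_mem _ fun n _ =>
    Submodule.smul_mem _ _ (Submodule.subset_span ⟨n, rfl⟩)

/-- `⟨𝒳*⟩` is a `K⁻¹`-norming subspace of `𝕏*` iff for each `ε > 0` and each
finite-dimensional subspace `𝕍 ⊆ 𝕏` there is `m(𝕍,ε)` such that `‖f‖ ≤ (K + ε)‖f + g‖` for
every `f ∈ 𝕍` and every `g` in the closed linear span of `𝒳_{>m(𝕍,ε)}`. -/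
theorem norming_iff_uniform_tail_estimate_on_finite_dimensional
    {𝕜 : Type*} [RCLike 𝕜] {X : Type*} [NormedAddCommGroup X] [NormedSpace 𝕜 X]
    [CompleteSpace X] [TopologicalSpace.SeparableSpace X]
    (hinf : ¬ FiniteDimensional 𝕜 X)
    (x : ℕ → X) (xs : ℕ → X →L[𝕜] 𝕜)
    (hdense : Dense (Submodule.span 𝕜 (Set.range x) : Set X))
    (hbi : ∀ n k, xs n (x k) = if n = k then 1 else 0)
    (K : ℝ) (hK : 1 ≤ K) :
    (∀ f : X, K⁻¹ * ‖f‖ ≤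
        sSup {r : ℝ | ∃ g ∈ Submodule.span 𝕜 (Set.range xs), ‖g‖ ≤ 1 ∧ r = ‖g f‖}) ↔
    (∀ ε : ℝ, 0 < ε → ∀ V : Submodule 𝕜 X, FiniteDimensional 𝕜 V → ∃ m : ℕ,
      ∀ f ∈ V, ∀ g ∈ (Submodule.span 𝕜 (x '' {n | m < n})).topologicalClosure,
        ‖f‖ ≤ (K + ε) * ‖f + g‖) := by
  have hK0 : 0 < K := by linarith
  constructor
  · intro hN ε hε V hV
    have hKε : 0 < K + ε := by linarith
    have hc : (K + ε)⁻¹ < K⁻¹ := inv_strictAnti₀ hK0 (by linarith)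
    have : ProperSpace V := FiniteDimensional.proper_rclike 𝕜 V
    let U : ℕ → Set V := fun m => {f : V | ∃ φ : X →L[𝕜] 𝕜, ‖φ‖ ≤ 1 ∧
      (∀ n, m < n → φ (x n) = 0) ∧ (K + ε)⁻¹ < ‖φ (f : X)‖}
    have hU : ∀ m, IsOpen (U m) := by
      intro m
      have : U m = ⋃ φ ∈ {φ : X →L[𝕜] 𝕜 | ‖φ‖ ≤ 1 ∧ ∀ n, m < n → φ (x n) = 0},
          {f : V | (K + ε)⁻¹ < ‖φ (f : X)‖} := by
        ext f
        simp [U, and_assoc]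
      rw [this]
      exact isOpen_biUnion fun φ _ => isOpen_lt continuous_const (by fun_prop)
    have hmono : Monotone U := by
      rintro a b hab f ⟨φ, h1, h2, h3⟩
      exact ⟨φ, h1, fun n hn => h2 n (by omega), h3⟩
    have hcov : Metric.sphere (0 : V) 1 ⊆ ⋃ m, U m := by
      intro f hf
      have hf1 : ‖(f : X)‖ = 1 := by simpa using hf
      have h1 := hN (f : X)
      rw [hf1, mul_one] at h1
      obtain ⟨r, ⟨φ, hφ, hφ1, rfl⟩, hr⟩ := exists_lt_of_lt_csSup
        (by exact ⟨_, 0, Submodule.zero_mem _, by simp, rfl⟩) (hc.trans_le h1)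
      obtain ⟨m, hm⟩ := exists_tail_vanish x xs hbi φ hφ
      exact Set.mem_iUnion.2 ⟨m, φ, hφ1, hm, hr⟩
    obtain ⟨m, hm⟩ := (isCompact_sphere (0 : V) 1).elim_directed_cover U hU hcov
      hmono.directed_le
    refine ⟨m, fun f hf g hg => ?_⟩
    by_cases hf0 : f = 0
    · rw [hf0, norm_zero]; positivity
    have hfn : 0 < ‖f‖ := norm_pos_iff.2 hf0
    obtain ⟨φ, h1, h2, h3⟩ := hm (show ((‖f‖⁻¹ : ℝ) : 𝕜) • (⟨f, hf⟩ : V) ∈ Metric.sphere (0 : V) 1 by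
      rw [mem_sphere_zero_iff_norm, norm_smul, RCLike.norm_ofReal, abs_of_pos (inv_pos.2 hfn)]
      exact inv_mul_cancel₀ hfn.ne')
    have h4 : φ g = 0 := vanish_on_closure x φ m h2 g hg
    have h5 : ‖φ f‖ ≤ ‖f + g‖ := by
      calc ‖φ f‖ = ‖φ (f + g)‖ := by rw [map_add, h4, add_zero]
        _ ≤ 1 * ‖f + g‖ := φ.le_of_opNorm_le h1 _
        _ = _ := one_mul _
    have h6 : (K + ε)⁻¹ < ‖f‖⁻¹ * ‖φ f‖ := by
      have h7 : φ (((‖f‖⁻¹ : ℝ) : 𝕜) • f) = ((‖f‖⁻¹ : ℝ) : 𝕜) * φ f := by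
        rw [map_smul, smul_eq_mul]
      have h8 : (K + ε)⁻¹ < ‖φ (((‖f‖⁻¹ : ℝ) : 𝕜) • f)‖ := h3
      rwa [h7, norm_mul, RCLike.norm_ofReal, abs_of_pos (inv_pos.2 hfn)] at h8
    rw [inv_mul_eq_div, lt_div_iff₀ hfn, inv_mul_eq_div, div_lt_iff₀ hKε] at h6
    nlinarith
  · intro hT f
    set S := {r : ℝ | ∃ g ∈ Submodule.span 𝕜 (Set.range xs), ‖g‖ ≤ 1 ∧ r = ‖g f‖} with hS
    have hbdd : BddAbove S := by
      refine ⟨‖f‖, ?_⟩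
      rintro _ ⟨φ, -, h1, rfl⟩
      simpa using φ.le_of_opNorm_le h1 f
    have key : ∀ ε : ℝ, 0 < ε → ‖f‖ ≤ (K + ε) * sSup S := by
      intro ε hε
      have hKε : 0 < K + ε := by linarith
      obtain ⟨m, hm⟩ := hT ε hε (Submodule.span 𝕜 {f}) inferInstance
      set Y := (Submodule.span 𝕜 (x '' {n | m < n})).topologicalClosure with hY
      obtain ⟨ψ, hψ1, hψ2⟩ := exists_dual_vector'' 𝕜 (Submodule.Quotient.mk f : X ⧸ Y)
      let φ : X →L[𝕜] 𝕜 := ψ.comp Y.mkQL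
      have hφa : ∀ z, φ z = ψ (Submodule.Quotient.mk z) := fun z => rfl
      have hφ1 : ‖φ‖ ≤ 1 := by
        refine φ.opNorm_le_bound zero_le_one fun z => ?_
        rw [hφa]
        refine (ψ.le_of_opNorm_le hψ1 _).trans ?_
        rw [one_mul, one_mul]
        exact Submodule.Quotient.norm_mk_le Y z
      have hφ2 : ∀ n, m < n → φ (x n) = 0 := by
        intro n hn
        have : (Submodule.Quotient.mk (x n) : X ⧸ Y) = 0 := by
          rw [Submodule.Quotient.mk_eq_zero]
          exact Submodule.le_topologicalClosure _ (Submodule.subset_span ⟨n, hn, rfl⟩)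
        rw [hφa, this, map_zero]
      have hmem : ‖φ f‖ ∈ S := ⟨φ, mem_span_of_tail x xs hdense hbi φ m hφ2, hφ1, rfl⟩
      have hle := le_csSup hbdd hmem
      have hφf : ‖φ f‖ = ‖(Submodule.Quotient.mk f : X ⧸ Y)‖ := by
        rw [hφa, hψ2, RCLike.norm_ofReal, abs_of_nonneg (norm_nonneg _)]
      have hq : (K + ε)⁻¹ * ‖f‖ ≤ ‖(Submodule.Quotient.mk f : X ⧸ Y)‖ := by
        refine le_of_forall_pos_le_add fun δ hδ => ?_
        obtain ⟨z, hz, hz2⟩ :=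
          Submodule.Quotient.norm_mk_lt (Submodule.Quotient.mk f : X ⧸ Y) hδ
        have h1 := hm f (Submodule.mem_span_singleton_self f) (z - f)
          ((Submodule.Quotient.eq Y).1 hz)
        rw [add_sub_cancel] at h1
        refine le_trans ?_ hz2.le
        rwa [inv_mul_le_iff₀ hKε]
      rw [← inv_mul_le_iff₀ hKε]
      linarith
    rw [inv_mul_le_iff₀ hK0]
    have hlim : Filter.Tendsto (fun ε : ℝ => (K + ε) * sSup S) (nhdsWithin 0 (Set.Ioi 0))
        (nhds (K * sSup S)) := by
      have : Continuous fun ε : ℝ => (K + ε) * sSup S := by fun_prop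
      simpa using (this.tendsto 0).mono_left nhdsWithin_le_nhds
    exact ge_of_tendsto hlim (eventually_mem_nhdsWithin.mono fun ε hε => key ε hε)
end

section
/- Let 𝒳 be a fundamental minimal system for 𝕏, let (d_j)_{j≥1} be an unbounded sequence of positive integers, and let (t_j)_{j≥1} be scalars with 0 < t_j < 1 for all j. Suppose that for every f ∈ 𝕏 there is a sequence (A_{f,j})_{j≥1}, where A_{f,j} is a t_j-greedy set of f with |A_{f,j}| = d_j for each j, such that the sequence (P_{A_{f,j}}(f))_{j≥1} is bounded in 𝕏. Then the linear span ⟨𝒳*⟩ of the dual system is a norming subspace of 𝕏*. -/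
section helpers

variable {𝕜 : Type*} [RCLike 𝕜] {X : Type*} [NormedAddCommGroup X] [NormedSpace 𝕜 X]

/-- Finite supports of elements of the span. -/
theorem span_finite_support (x : ℕ → X) (xs : ℕ → X →L[𝕜] 𝕜)
    (hbi : ∀ n k, xs n (x k) = if n = k then 1 else 0) (y : X)
    (hy : y ∈ Submodule.span 𝕜 (Set.range x)) :
    ∃ S : Finset ℕ, ∀ B : Finset ℕ, S ⊆ B →
      (∀ k ∉ B, xs k y = 0) ∧ ∑ n ∈ B, xs n y • x n = y := by
  induction hy using Submodule.span_induction with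
  | mem y hy =>
    obtain ⟨k, rfl⟩ := hy
    refine ⟨{k}, fun B hB => ⟨fun n hn => ?_, ?_⟩⟩
    · have : n ≠ k := fun e => hn (hB (by simp [e]))
      simp [hbi, this]
    · have hk : k ∈ B := hB (by simp)
      simp [hbi, ite_smul, hk]
  | zero => exact ⟨∅, fun B _ => ⟨by simp, by simp⟩⟩
  | add y z _ _ ihy ihz =>
    obtain ⟨S, hS⟩ := ihy
    obtain ⟨T, hT⟩ := ihz
    refine ⟨S ∪ T, fun B hB => ?_⟩
    obtain ⟨h1, h2⟩ := hS B (Finset.union_subset_left hB)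
    obtain ⟨h3, h4⟩ := hT B (Finset.union_subset_right hB)
    refine ⟨fun k hk => by simp [h1 k hk, h3 k hk], ?_⟩
    simp only [map_add, add_smul, Finset.sum_add_distrib, h2, h4]
  | smul a y _ ih =>
    obtain ⟨S, hS⟩ := ih
    refine ⟨S, fun B hB => ?_⟩
    obtain ⟨h1, h2⟩ := hS B hB
    refine ⟨fun k hk => by simp [h1 k hk], ?_⟩
    simp only [map_smul, smul_eq_mul, mul_smul, ← Finset.smul_sum, h2]

theorem span_compl_coef (x : ℕ → X) (xs : ℕ → X →L[𝕜] 𝕜)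
    (hbi : ∀ n k, xs n (x k) = if n = k then 1 else 0) (B : Finset ℕ) (y : X)
    (hy : y ∈ Submodule.span 𝕜 (Set.image x (↑B : Set ℕ)ᶜ)) : ∀ n ∈ B, xs n y = 0 := by
  intro n hn
  induction hy using Submodule.span_induction with
  | mem y hy =>
    obtain ⟨k, hk, rfl⟩ := hy
    have : n ≠ k := fun e => hk (by simpa [e] using hn)
    simp [hbi, this]
  | zero => simp
  | add y z _ _ ihy ihz => simp [ihy, ihz]
  | smul a y _ ih => simp [ih]

/-- Hahn-Banach step. -/
theorem hahn_banach_step (x : ℕ → X) (xs : ℕ → X →L[𝕜] 𝕜)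
    (hdense : Dense (Submodule.span 𝕜 (Set.range x) : Set X))
    (hbi : ∀ n k, xs n (x k) = if n = k then 1 else 0) (f : X) (η : ℝ)
    (hf : ∀ g ∈ Submodule.span 𝕜 (Set.range xs), ‖g‖ ≤ 1 → ‖g f‖ ≤ η) (r : ℝ) (hr : η < r)
    (B : Finset ℕ) :
    ∃ y ∈ Submodule.span 𝕜 (Set.image x (↑B : Set ℕ)ᶜ), ‖f + y‖ < r := by
  set W := Submodule.span 𝕜 (Set.image x (↑B : Set ℕ)ᶜ) with hW
  obtain ⟨φ, hφ1, hφ⟩ := exists_dual_vector'' 𝕜 (Submodule.Quotient.mk f : X ⧸ W)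
  let g : X →L[𝕜] 𝕜 := φ.comp W.mkQL
  have hgval : ∀ z, g z = φ (Submodule.Quotient.mk z : X ⧸ W) := fun z => rfl
  have hg1 : ‖g‖ ≤ 1 := by
    refine ContinuousLinearMap.opNorm_le_bound _ zero_le_one fun z => ?_
    rw [hgval]
    refine (φ.le_of_opNorm_le hφ1 _).trans ?_
    gcongr
    exact Submodule.Quotient.norm_mk_le W z
  have hgeq : g = ∑ n ∈ B, g (x n) • xs n := by
    refine ContinuousLinearMap.ext_on hdense ?_
    rintro _ ⟨k, rfl⟩
    simp only [sum_apply, smul_apply, hbi, smul_eq_mul,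
      mul_ite, mul_one, mul_zero, Finset.sum_ite_eq']
    split_ifs with hk
    · rfl
    · rw [hgval, (Submodule.Quotient.mk_eq_zero W).2, map_zero]
      exact Submodule.subset_span ⟨k, by simpa using hk, rfl⟩
  have hgmem : g ∈ Submodule.span 𝕜 (Set.range xs) := by
    rw [hgeq]
    exact Submodule.sum_mem _ fun n _ => Submodule.smul_mem _ _ (Submodule.subset_span ⟨n, rfl⟩)
  have h1 := hf g hgmem hg1
  rw [hgval, hφ] at h1
  have h2 : ‖(Submodule.Quotient.mk f : X ⧸ W)‖ ≤ η := by simpa using h1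
  obtain ⟨m, hm, hm2⟩ := Submodule.Quotient.norm_mk_lt (Submodule.Quotient.mk f : X ⧸ W)
    (sub_pos.2 (h2.trans_lt hr))
  refine ⟨m - f, (Submodule.Quotient.eq W).1 hm, ?_⟩
  simpa using hm2

/-- Averaging step. -/
theorem averaging_step (x : ℕ → X) (xs : ℕ → X →L[𝕜] 𝕜)
    (hbi : ∀ n k, xs n (x k) = if n = k then 1 else 0) (K : ℝ) (hK0 : 0 ≤ K)
    (hK : ∀ k z, ‖xs k z‖ ≤ K * ‖z‖) (f : X) (r : ℝ)
    (hf : ∀ B : Finset ℕ, ∃ y ∈ Submodule.span 𝕜 (Set.image x (↑B : Set ℕ)ᶜ), ‖f + y‖ < r)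
    (B : Finset ℕ) (m : ℕ) :
    ∃ y ∈ Submodule.span 𝕜 (Set.image x (↑B : Set ℕ)ᶜ), ‖(m : 𝕜) • f + y‖ ≤ m * r ∧
      ∀ k, ‖xs k y‖ ≤ K * (‖f‖ + r) := by
  have hr : 0 < r := by
    obtain ⟨y, -, hy⟩ := hf ∅
    exact (norm_nonneg _).trans_lt hy
  induction m with
  | zero => exact ⟨0, Submodule.zero_mem _, by simp, fun k => by simp; positivity⟩
  | succ m ih =>
    obtain ⟨y, hy, hy1, hy2⟩ := ih
    obtain ⟨S, hS⟩ := span_finite_support x xs hbi y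
      (Submodule.span_mono (Set.image_subset_range _ _) hy)
    obtain ⟨z, hz, hz1⟩ := hf (B ∪ S)
    have hz0 := span_compl_coef x xs hbi _ z hz
    have hyS := (hS (B ∪ S) Finset.subset_union_right).1
    refine ⟨y + z, Submodule.add_mem _ hy (Submodule.span_mono (Set.image_mono ?_) hz), ?_, ?_⟩
    · intro n hn hnB
      exact hn (by simp at hnB ⊢; exact Or.inl hnB)
    · have : ((m + 1 : ℕ) : 𝕜) • f + (y + z) = ((m : 𝕜) • f + y) + (f + z) := by
        push_cast
        rw [add_smul, one_smul]; abel
      rw [this]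
      refine (norm_add_le _ _).trans ?_
      push_cast
      linarith
    · intro k
      by_cases hk : k ∈ B ∪ S
      · simpa [hz0 k hk] using hy2 k
      · rw [map_add, hyS k hk, zero_add]
        refine (hK k z).trans ?_
        gcongr
        have : z = (f + z) - f := by abel
        calc ‖z‖ = ‖(f + z) - f‖ := by rw [← this]
          _ ≤ ‖f + z‖ + ‖f‖ := norm_sub_le _ _
          _ ≤ ‖f‖ + r := by linarith

theorem small_coef_step (x : ℕ → X) (xs : ℕ → X →L[𝕜] 𝕜)
    (hbi : ∀ n k, xs n (x k) = if n = k then 1 else 0) (K : ℝ) (hK0 : 0 ≤ K)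
    (hK : ∀ k z, ‖xs k z‖ ≤ K * ‖z‖) (f : X) (r : ℝ)
    (hf : ∀ B : Finset ℕ, ∃ y ∈ Submodule.span 𝕜 (Set.image x (↑B : Set ℕ)ᶜ), ‖f + y‖ < r)
    (B : Finset ℕ) (δ : ℝ) (hδ : 0 < δ) :
    ∃ y ∈ Submodule.span 𝕜 (Set.image x (↑B : Set ℕ)ᶜ), ‖f + y‖ ≤ r ∧ ∀ k, ‖xs k y‖ ≤ δ := by
  obtain ⟨m, hm⟩ := exists_nat_gt (K * (‖f‖ + r) / δ)
  obtain ⟨y, hy, hy1, hy2⟩ := averaging_step x xs hbi K hK0 hK f r hf B (m + 1)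
  have hm0 : (0 : ℝ) < (m + 1 : ℕ) := by positivity
  have hmk : ((m + 1 : ℕ) : 𝕜) ≠ 0 := by exact_mod_cast Nat.succ_ne_zero m
  refine ⟨((m + 1 : ℕ) : 𝕜)⁻¹ • y, Submodule.smul_mem _ _ hy, ?_, fun k => ?_⟩
  · have : f + ((m + 1 : ℕ) : 𝕜)⁻¹ • y = ((m + 1 : ℕ) : 𝕜)⁻¹ • (((m + 1 : ℕ) : 𝕜) • f + y) := by
      rw [smul_add, smul_smul, inv_mul_cancel₀ hmk, one_smul]
    rw [this, norm_smul, norm_inv, RCLike.norm_natCast, inv_mul_le_iff₀ hm0]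
    exact hy1
  · rw [map_smul, norm_smul, norm_inv, RCLike.norm_natCast, inv_mul_le_iff₀ hm0]
    refine (hy2 k).trans ?_
    rw [div_lt_iff₀ hδ] at hm
    push_cast
    nlinarith

/-- Failure of norming yields large vectors in the span on which the dual system is small. -/
theorem not_norming_vector (x : ℕ → X) (xs : ℕ → X →L[𝕜] 𝕜)
    (hdense : Dense (Submodule.span 𝕜 (Set.range x) : Set X))
    (hn : ¬ ∃ c : ℝ, 0 < c ∧ c ≤ 1 ∧ ∀ f : X, c * ‖f‖ ≤
      sSup {r : ℝ | ∃ g ∈ Submodule.span 𝕜 (Set.range xs), ‖g‖ ≤ 1 ∧ r = ‖g f‖})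
    (N η : ℝ) (hN : 0 < N) (hη : 0 < η) :
    ∃ f ∈ Submodule.span 𝕜 (Set.range x), N ≤ ‖f‖ ∧
      ∀ g ∈ Submodule.span 𝕜 (Set.range xs), ‖g‖ ≤ 1 → ‖g f‖ ≤ η := by
  push Not at hn
  set c : ℝ := min 1 (η / (N + η) / 2) with hc
  have hc0 : 0 < c := by positivity
  have hc1 : c ≤ 1 := min_le_left _ _
  obtain ⟨f, hf⟩ := hn c hc0 hc1
  have hbdd : BddAbove {r : ℝ | ∃ g ∈ Submodule.span 𝕜 (Set.range xs), ‖g‖ ≤ 1 ∧ r = ‖g f‖} := by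
    refine ⟨1 * ‖f‖, ?_⟩
    rintro _ ⟨g, -, hg, rfl⟩
    exact g.le_of_opNorm_le hg f
  have hg : ∀ g ∈ Submodule.span 𝕜 (Set.range xs), ‖g‖ ≤ 1 → ‖g f‖ ≤ c * ‖f‖ := fun g h1 h2 =>
    (le_csSup hbdd ⟨g, h1, h2, rfl⟩).trans hf.le
  have hf0 : 0 < ‖f‖ := by
    have h0 : 0 ≤ sSup {r : ℝ | ∃ g ∈ Submodule.span 𝕜 (Set.range xs), ‖g‖ ≤ 1 ∧ r = ‖g f‖} :=
      le_csSup hbdd ⟨0, Submodule.zero_mem _, by simp, by simp⟩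
    exact pos_of_mul_pos_right (h0.trans_lt hf) hc0.le
  obtain ⟨y, hy, hfy⟩ := Metric.dense_iff.1 hdense f (c * ‖f‖) (by positivity)
  have hyf : ‖f - y‖ < c * ‖f‖ := by
    rw [Metric.mem_ball, dist_comm, dist_eq_norm] at hy; exact hy
  have hcη : c ≤ η / (N + η) / 2 := min_le_right _ _
  have hcη2 : 2 * c * (N + η) ≤ η := by
    rw [div_div, le_div_iff₀ (by positivity)] at hcη
    linarith
  -- scale
  refine ⟨(((N + η) / ‖f‖ : ℝ) : 𝕜) • y, Submodule.smul_mem _ _ hfy, ?_, ?_⟩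
  · rw [norm_smul, RCLike.norm_ofReal, abs_of_pos (by positivity)]
    have h1 : (1 - c) * ‖f‖ ≤ ‖y‖ := by
      have := norm_sub_norm_le f y
      linarith
    calc N ≤ (N + η) * (1 - c) := by nlinarith
      _ = (N + η) / ‖f‖ * ((1 - c) * ‖f‖) := by field_simp
      _ ≤ _ := by gcongr
  · intro g hg1 hg2
    rw [map_smul, norm_smul, RCLike.norm_ofReal, abs_of_pos (by positivity)]
    have h1 : ‖g y‖ ≤ 2 * c * ‖f‖ := by
      have : g y = g f - g (f - y) := by rw [map_sub]; ring
      rw [this]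
      have h3 := g.le_of_opNorm_le hg2 (f - y)
      have h4 := hg g hg1 hg2
      have := norm_sub_le (g f) (g (f - y))
      linarith
    calc (N + η) / ‖f‖ * ‖g y‖ ≤ (N + η) / ‖f‖ * (2 * c * ‖f‖) := by gcongr
      _ = 2 * c * (N + η) := by field_simp
      _ ≤ η := hcη2

theorem coef_bound [CompleteSpace X] (xs : ℕ → X →L[𝕜] 𝕜) (d : ℕ) (hd : 0 < d) (t : ℝ) (ht : 0 < t)
    (h : ∀ f : X, ∃ A : Finset ℕ, A.card = d ∧ ∀ n ∈ A, ∀ k ∉ A, t * ‖xs k f‖ ≤ ‖xs n f‖) :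
    ∃ K : ℝ, 0 ≤ K ∧ ∀ k z, ‖xs k z‖ ≤ K * ‖z‖ := by
  obtain ⟨C, hC⟩ := banach_steinhaus (g := xs) (fun f => by
    obtain ⟨A, hA, hA2⟩ := h f
    obtain ⟨n, hn⟩ := Finset.card_pos.1 (hA ▸ hd)
    refine ⟨‖xs n f‖ / t + ∑ i ∈ A, ‖xs i f‖, fun k => ?_⟩
    have hs : 0 ≤ ∑ i ∈ A, ‖xs i f‖ := Finset.sum_nonneg fun i _ => norm_nonneg _
    by_cases hk : k ∈ A
    · have := Finset.single_le_sum (f := fun i => ‖xs i f‖) (fun i _ => norm_nonneg _) hk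
      have h2 : 0 ≤ ‖xs n f‖ / t := by positivity
      linarith
    · have : ‖xs k f‖ ≤ ‖xs n f‖ / t := by
        rw [le_div_iff₀ ht, mul_comm]; exact hA2 n hn k hk
      linarith)
  exact ⟨C, (norm_nonneg _).trans (hC 0), fun k z => (xs k).le_of_opNorm_le (hC k) z⟩

/-- Make all coefficients on a finite set nonzero by a small perturbation. -/
theorem perturb (x : ℕ → X) (xs : ℕ → X →L[𝕜] 𝕜)
    (hbi : ∀ n k, xs n (x k) = if n = k then 1 else 0) (y : X) (B : Finset ℕ) (ε : ℝ) (hε : 0 < ε)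
    (hB : (∀ k ∉ B, xs k y = 0) ∧ ∑ n ∈ B, xs n y • x n = y) :
    ∃ z, ‖z - y‖ < ε ∧ ((∀ k ∉ B, xs k z = 0) ∧ ∑ n ∈ B, xs n z • x n = z) ∧
      ∃ δ : ℝ, 0 < δ ∧ ∀ n ∈ B, δ < ‖xs n z‖ := by
  classical
  set σ : ℝ := ∑ n ∈ B, ‖x n‖ with hσ
  have hσ0 : 0 ≤ σ := Finset.sum_nonneg fun i _ => norm_nonneg _
  set s : ℝ := ε / (σ + 1) with hs
  have hs0 : 0 < s := by positivity
  let a : ℕ → 𝕜 := fun n => if xs n y = 0 then (s : 𝕜) else 0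
  have ha : ∀ n, ‖a n‖ ≤ s := fun n => by
    simp only [a]; split_ifs
    · simp [abs_of_pos hs0]
    · simpa using hs0.le
  have hcoef : ∀ k, xs k (∑ n ∈ B, a n • x n) = if k ∈ B then a k else 0 := fun k => by
    simp [map_sum, hbi]
  refine ⟨y + ∑ n ∈ B, a n • x n, ?_, ⟨?_, ?_⟩, ?_⟩
  · rw [add_sub_cancel_left]
    calc ‖∑ n ∈ B, a n • x n‖ ≤ ∑ n ∈ B, s * ‖x n‖ := norm_sum_le_of_le _ fun n _ => by
          rw [norm_smul]; gcongr; exact ha n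
      _ = s * σ := by rw [hσ, Finset.mul_sum]
      _ < s * (σ + 1) := by nlinarith
      _ = ε := by rw [hs]; field_simp
  · intro k hk
    rw [map_add, hcoef, hB.1 k hk]; simp [hk]
  · simp only [map_add, add_smul, Finset.sum_add_distrib, hB.2]
    congr 1
    refine Finset.sum_congr rfl fun n hn => ?_
    rw [hcoef, if_pos hn]
  · have hne : ∀ n ∈ B, 0 < ‖xs n (y + ∑ n ∈ B, a n • x n)‖ := fun n hn => by
      rw [norm_pos_iff, map_add, hcoef, if_pos hn]
      simp only [a]
      split_ifs with h0
      · simpa [h0] using hs0.ne'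
      · simpa using h0
    generalize (y + ∑ n ∈ B, a n • x n) = z at hne
    rcases B.eq_empty_or_nonempty with rfl | hBn
    · exact ⟨1, one_pos, by simp⟩
    · obtain ⟨n, hn, hmin⟩ := B.exists_min_image (fun n => ‖xs n z‖) hBn
      refine ⟨‖xs n z‖ / 2, half_pos (hne n hn), fun k hk => ?_⟩
      have := hmin k hk
      have := hne n hn
      linarith

end helpers

/-- If `(d_j)` is an unbounded sequence of positive integers, `0 < t_j < 1`, and
for every `f ∈ 𝕏` there is a sequence `(A_{f,j})` of `t_j`-greedy sets of `f` with
`|A_{f,j}| = d_j` such that `(P_{A_{f,j}}(f))_j` is bounded, then `⟨𝒳*⟩` is a norming subspace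
of `𝕏*`. -/
theorem pointwise_bounded_weak_greedy_implies_norming
    {𝕜 : Type*} [RCLike 𝕜] {X : Type*} [NormedAddCommGroup X] [NormedSpace 𝕜 X]
    [CompleteSpace X] [TopologicalSpace.SeparableSpace X]
    (hinf : ¬ FiniteDimensional 𝕜 X)
    (x : ℕ → X) (xs : ℕ → X →L[𝕜] 𝕜)
    (hdense : Dense (Submodule.span 𝕜 (Set.range x) : Set X))
    (hbi : ∀ n k, xs n (x k) = if n = k then 1 else 0)
    (d : ℕ → ℕ) (hd1 : ∀ j, 0 < d j) (hdu : ∀ N : ℕ, ∃ j, N < d j)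
    (t : ℕ → ℝ) (ht0 : ∀ j, 0 < t j) (ht1 : ∀ j, t j < 1)
    (h : ∀ f : X, ∃ A : ℕ → Finset ℕ,
      (∀ j, (A j).card = d j ∧ ∀ n ∈ A j, ∀ k ∉ A j, t j * ‖xs k f‖ ≤ ‖xs n f‖) ∧
      ∃ M : ℝ, ∀ j, ‖∑ n ∈ A j, xs n f • x n‖ ≤ M) :
    ∃ c : ℝ, 0 < c ∧ c ≤ 1 ∧ ∀ f : X, c * ‖f‖ ≤
      sSup {r : ℝ | ∃ g ∈ Submodule.span 𝕜 (Set.range xs), ‖g‖ ≤ 1 ∧ r = ‖g f‖} := by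
  classical
  by_contra hnot
  obtain ⟨K, hK0, hK⟩ := coef_bound xs (d 0) (hd1 0) (t 0) (ht0 0) (fun f => by
    obtain ⟨A, hA, -⟩ := h f
    exact ⟨A 0, hA 0⟩)
  let U : ℕ → Set X := fun N => {F | ∃ j, ∀ A : Finset ℕ, A.card = d j →
    (∀ n ∈ A, ∀ k ∉ A, t j * ‖xs k F‖ ≤ ‖xs n F‖) → (N : ℝ) < ‖∑ n ∈ A, xs n F • x n‖}
  have hU : ∀ N, Dense (interior (U N)) := by
    intro N
    rw [Metric.dense_iff]
    intro F₁ ε hε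
    obtain ⟨F₀, hF₀, hF₀s⟩ := Metric.dense_iff.1 hdense F₁ (ε / 3) (by positivity)
    rw [Metric.mem_ball, dist_eq_norm] at hF₀
    obtain ⟨f, hfs, hfN, hf⟩ := not_norming_vector x xs hdense hnot (N + ‖F₀‖ + ε + 1) (ε / 6)
      (by positivity) (by positivity)
    have hstep := hahn_banach_step x xs hdense hbi f (ε / 6) hf (ε / 3) (by linarith)
    obtain ⟨S, hS⟩ := span_finite_support x xs hbi (F₀ + f) (Submodule.add_mem _ hF₀s hfs)
    obtain ⟨j, hj⟩ := hdu S.card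
    obtain ⟨B, hSB, hBc⟩ := Infinite.exists_superset_card_eq S (d j) hj.le
    obtain ⟨z, hz, hzB, δ, hδ, hδB⟩ := perturb x xs hbi (F₀ + f) B (ε / 3) (by positivity) (hS B hSB)
    have htδ : 0 < t j * δ := mul_pos (ht0 j) hδ
    obtain ⟨y, hy, hy1, hy2⟩ := small_coef_step x xs hbi K hK0 hK f (ε / 3) hstep B (t j * δ / 2)
      (by positivity)
    have hyB := span_compl_coef x xs hbi B y hy
    have hPB : ∑ n ∈ B, xs n (z + y) • x n = z := by
      rw [← hzB.2]
      refine Finset.sum_congr rfl fun n hn => ?_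
      rw [hzB.2, map_add, hyB n hn, add_zero]
    refine ⟨z + y, ?_, ?_⟩
    · rw [Metric.mem_ball, dist_eq_norm]
      have : z + y - F₁ = (z - (F₀ + f)) + (f + y) + (F₀ - F₁) := by abel
      rw [this]
      have h1 := norm_add₃_le (a := z - (F₀ + f)) (b := f + y) (c := F₀ - F₁)
      linarith
    · rw [mem_interior_iff_mem_nhds]
      have e1 : ∀ᶠ G in nhds (z + y), ∀ n ∈ B, δ < ‖xs n G‖ := by
        rw [Filter.eventually_all_finset]
        intro n hn
        have hc : Continuous fun G => ‖xs n G‖ := by fun_prop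
        refine hc.continuousAt.eventually (lt_mem_nhds ?_)
        beta_reduce
        rw [map_add, hyB n hn, add_zero]
        exact hδB n hn
      have e2 : ∀ᶠ G in nhds (z + y), (N : ℝ) < ‖∑ n ∈ B, xs n G • x n‖ := by
        have hc : Continuous fun G => ‖∑ n ∈ B, xs n G • x n‖ := by fun_prop
        refine hc.continuousAt.eventually (lt_mem_nhds ?_)
        beta_reduce
        rw [hPB]
        have h1 : f = z - (z - (F₀ + f)) - F₀ := by abel
        have h2 : ‖f‖ ≤ ‖z‖ + ‖z - (F₀ + f)‖ + ‖F₀‖ := by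
          calc ‖f‖ = ‖z - (z - (F₀ + f)) - F₀‖ := by rw [← h1]
            _ ≤ ‖z - (z - (F₀ + f))‖ + ‖F₀‖ := norm_sub_le _ _
            _ ≤ _ := by gcongr; exact norm_sub_le _ _
        linarith
      have e3 : ∀ᶠ G in nhds (z + y), ∀ k ∉ B, ‖xs k G‖ < t j * δ := by
        have hc : Continuous fun G => K * ‖G - (z + y)‖ := by fun_prop
        have : ∀ᶠ G in nhds (z + y), K * ‖G - (z + y)‖ < t j * δ / 2 := by
          refine hc.continuousAt.eventually (gt_mem_nhds ?_)
          simpa using htδ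
        filter_upwards [this] with G hG k hk
        have h1 : xs k G = xs k (G - (z + y)) + xs k y := by
          simp [map_sub, hzB.1 k hk]
        rw [h1]
        have h2 := norm_add_le (xs k (G - (z + y))) (xs k y)
        have h3 := hK k (G - (z + y))
        have h4 := hy2 k
        linarith
      filter_upwards [e1, e2, e3] with G h1 h2 h3
      refine ⟨j, fun A hA hgr => ?_⟩
      have hAB : A = B := by
        by_contra hne
        have hAn : ¬ A ⊆ B := fun hs => hne (Finset.eq_of_subset_of_card_le hs (by omega))
        have hBn : ¬ B ⊆ A := fun hs => hne (Finset.eq_of_subset_of_card_le hs (by omega)).symm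
        obtain ⟨n, hnA, hnB⟩ := Finset.not_subset.1 hAn
        obtain ⟨k, hkB, hkA⟩ := Finset.not_subset.1 hBn
        have h4 := hgr n hnA k hkA
        have h5 := h3 n hnB
        have h6 := mul_lt_mul_of_pos_left (h1 k hkB) (ht0 j)
        linarith
      rw [hAB]; exact h2
  obtain ⟨F, hF⟩ := (dense_iInter_of_isOpen_nat (fun N => isOpen_interior) hU).nonempty
  obtain ⟨A, hA, M, hM⟩ := h F
  obtain ⟨N, hN⟩ := exists_nat_gt M
  obtain ⟨j, hj⟩ := interior_subset (Set.mem_iInter.1 hF N)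
  have h1 := hj (A j) (hA j).1 (hA j).2
  have h2 := hM j
  linarith
end

section
/- Let 𝒳 be a bounded Markushevich basis for 𝕏 (sup_n ‖x_n‖ < ∞) whose dual system 𝒳* is also bounded. Suppose that 𝕏 has a complemented subspace ℤ with a subsymmetric basis 𝒵 whose upper superdemocracy function has both the LRP and the URP. Then 𝕏 has a bidemocratic Markushevich basis 𝒴 that has a block basis equivalent to 𝒳. -/
section

open Filter Topology

theorem aux_coord {𝕜 : Type*} [RCLike 𝕜] {E : Type*} [NormedAddCommGroup E] [NormedSpace 𝕜 E]
    [CompleteSpace E] (z : ℕ → E)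
    (hS : ∀ f : E, ∃! a : ℕ → 𝕜,
      Tendsto (fun N => ∑ n ∈ Finset.range N, a n • z n) atTop (𝓝 f)) :
    ∃ a : ℕ → E →L[𝕜] 𝕜, (∀ i j, a i (z j) = if i = j then 1 else 0) ∧
      ∀ f, Tendsto (fun N => ∑ n ∈ Finset.range N, a n f • z n) atTop (𝓝 f) := by
  classical
  have hz : ∀ n, z n ≠ 0 := by
    intro n hn
    obtain ⟨a, ha, hu⟩ := hS 0
    have h0 := hu 0 (by simp)
    have h1 := hu (Pi.single n 1) (by
      have : ∀ N, ∑ k ∈ Finset.range N, (Pi.single n (1 : 𝕜) : ℕ → 𝕜) k • z k = 0 := by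
        intro N
        apply Finset.sum_eq_zero
        intro k _
        by_cases hk : k = n
        · subst hk; simp [hn]
        · simp [Pi.single_eq_of_ne hk]
      simp [this])
    have := congrFun (h0.trans h1.symm) n
    simp at this
  let G : Submodule 𝕜 C(OnePoint ℕ, E) :=
    { carrier := {S | S ((0 : ℕ) : OnePoint ℕ) = 0 ∧
        ∀ n : ℕ, S ((n + 1 : ℕ) : OnePoint ℕ) - S ((n : ℕ) : OnePoint ℕ) ∈ Submodule.span 𝕜 {z n}}
      add_mem' := by
        rintro S T ⟨h1, h2⟩ ⟨h3, h4⟩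
        refine ⟨by simp [h1, h3], fun n => ?_⟩
        have := Submodule.add_mem _ (h2 n) (h4 n)
        simp only [ContinuousMap.add_apply]
        convert this using 1
        abel
      zero_mem' := by simp
      smul_mem' := by
        rintro c S ⟨h1, h2⟩
        refine ⟨by simp [h1], fun n => ?_⟩
        have := Submodule.smul_mem _ c (h2 n)
        simpa [smul_sub] using this }
  have hGc : IsClosed (G : Set C(OnePoint ℕ, E)) := by
    have : (G : Set C(OnePoint ℕ, E)) = {S | S ((0 : ℕ) : OnePoint ℕ) = 0} ∩
        ⋂ n : ℕ, {S | S ((n + 1 : ℕ) : OnePoint ℕ) - S ((n : ℕ) : OnePoint ℕ) ∈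
          (Submodule.span 𝕜 {z n} : Set E)} := by
      ext S
      simp only [Set.mem_inter_iff, Set.mem_iInter, Set.mem_setOf_eq]
      rfl
    rw [this]
    refine IsClosed.inter (isClosed_eq (by fun_prop) continuous_const) (isClosed_iInter fun n => ?_)
    exact IsClosed.preimage (f := fun S : C(OnePoint ℕ, E) =>
      S ((n + 1 : ℕ) : OnePoint ℕ) - S ((n : ℕ) : OnePoint ℕ)) (by fun_prop)
      (Submodule.closed_of_finiteDimensional _)
  haveI : CompleteSpace G := hGc.completeSpace_coe
  let ev : G →L[𝕜] E :=
    { toFun := fun S => (S : C(OnePoint ℕ, E)) OnePoint.infty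
      map_add' := by intros; rfl
      map_smul' := by intros; rfl
      cont := by fun_prop }
  -- representation of elements of G
  have hrep : ∀ S : G, ∃ c : ℕ → 𝕜, ∀ N : ℕ,
      (S : C(OnePoint ℕ, E)) (N : OnePoint ℕ) = ∑ n ∈ Finset.range N, c n • z n := by
    intro S
    have h2 := S.2.2
    simp only [Submodule.mem_span_singleton] at h2
    choose c hc using h2
    refine ⟨c, fun N => ?_⟩
    induction N with
    | zero => simpa using S.2.1
    | succ N ih => rw [Finset.sum_range_succ, ← ih, hc]; abel
  have hlim : ∀ S : G, Tendsto (fun N : ℕ => (S : C(OnePoint ℕ, E)) (N : OnePoint ℕ)) atTop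
      (𝓝 (ev S)) := fun S =>
    (OnePoint.continuous_iff_from_nat _).1 (S : C(OnePoint ℕ, E)).continuous
  have hinj : LinearMap.ker (ev : G →ₗ[𝕜] E) = ⊥ := by
    rw [LinearMap.ker_eq_bot']
    intro S hS0
    obtain ⟨c, hc⟩ := hrep S
    have h1 := hlim S
    simp only [hc] at h1
    have hev : ev S = 0 := hS0
    rw [hev] at h1
    obtain ⟨a, ha, hu⟩ := hS 0
    have hc0 : c = 0 := (hu c h1).trans (hu 0 (by simp)).symm
    ext t
    induction t using OnePoint.rec with
    | infty => exact hev
    | coe N => simp [hc N, hc0]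
  have hsurj : LinearMap.range (ev : G →ₗ[𝕜] E) = ⊤ := by
    rw [LinearMap.range_eq_top]
    intro f
    obtain ⟨a, ha, -⟩ := hS f
    refine ⟨⟨OnePoint.continuousMapMkNat _ f ha, ?_, ?_⟩, ?_⟩
    · simp [OnePoint.continuousMapMkNat, OnePoint.continuousMapMkDiscrete, OnePoint.continuousMapMk]
    · intro n
      simp [OnePoint.continuousMapMkNat, OnePoint.continuousMapMkDiscrete, OnePoint.continuousMapMk, Finset.sum_range_succ]
      exact Submodule.smul_mem _ _ (Submodule.mem_span_singleton_self _)
    · rfl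
  let e := ContinuousLinearEquiv.ofBijective ev hinj hsurj
  have he : ∀ f, ev (e.symm f) = f := fun f => e.apply_symm_apply f
  have hg : ∀ n, ∃ g : E →L[𝕜] 𝕜, g (z n) = 1 := fun n =>
    SeparatingDual.exists_eq_one (hz n)
  choose g hg using hg
  let evn : ℕ → G →L[𝕜] E := fun n =>
    { toFun := fun S => (S : C(OnePoint ℕ, E)) (n : OnePoint ℕ)
      map_add' := by intros; rfl
      map_smul' := by intros; rfl
      cont := by fun_prop }
  let a : ℕ → E →L[𝕜] 𝕜 := fun n => (g n).comp ((evn (n+1) - evn n).comp (e.symm : E →L[𝕜] G))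
  have hexp : ∀ f, Tendsto (fun N => ∑ n ∈ Finset.range N, a n f • z n) atTop (𝓝 f) := by
    intro f
    obtain ⟨c, hc⟩ := hrep (e.symm f)
    have h1 := hlim (e.symm f)
    rw [he] at h1
    have : ∀ n, a n f = c n := by
      intro n
      have : a n f = g n ((e.symm f : C(OnePoint ℕ, E)) ((n+1 : ℕ) : OnePoint ℕ) -
        (e.symm f : C(OnePoint ℕ, E)) ((n : ℕ) : OnePoint ℕ)) := rfl
      rw [this, hc, hc, Finset.sum_range_succ]
      simp [hg]
    simp only [hc] at h1
    simpa only [this] using h1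
  refine ⟨a, ?_, hexp⟩
  intro i j
  obtain ⟨b, hb, hu⟩ := hS (z j)
  have h1 := hu _ (hexp (z j))
  have h2 := hu (Pi.single j 1) (by
    apply tendsto_const_nhds.congr'
    filter_upwards [eventually_gt_atTop j] with N hN
    rw [Finset.sum_eq_single j]
    · simp
    · intro k _ hk; simp [Pi.single_eq_of_ne hk]
    · intro h; exact absurd (Finset.mem_range.2 hN) h)
  have := congrFun (h1.trans h2.symm) i
  simpa [Pi.single_apply] using this

/-- `v` and `w` are equivalent with constant `K`. -/
def AuxEqv (𝕜 : Type*) [RCLike 𝕜] {E : Type*} [NormedAddCommGroup E] [NormedSpace 𝕜 E]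
    (K : ℝ) (v w : ℕ → E) : Prop :=
  ∀ (F : Finset ℕ) (c : ℕ → 𝕜), ‖∑ i ∈ F, c i • v i‖ ≤ K * ‖∑ i ∈ F, c i • w i‖ ∧
    ‖∑ i ∈ F, c i • w i‖ ≤ K * ‖∑ i ∈ F, c i • v i‖

section
variable {𝕜 : Type*} [RCLike 𝕜] {E : Type*} [NormedAddCommGroup E] [NormedSpace 𝕜 E]

theorem AuxEqv.swap {K : ℝ} {v w : ℕ → E} (h : AuxEqv 𝕜 K v w) : AuxEqv 𝕜 K w v :=
  fun F c => ⟨(h F c).2, (h F c).1⟩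

theorem AuxEqv.mono {K L : ℝ} {v w : ℕ → E} (h : AuxEqv 𝕜 K v w) (hKL : K ≤ L) :
    AuxEqv 𝕜 L v w :=
  fun F c => ⟨(h F c).1.trans (by gcongr), (h F c).2.trans (by gcongr)⟩

theorem AuxEqv.comb {K L : ℝ} {u v w : ℕ → E} (hK : 0 ≤ K) (hL : 0 ≤ L) (h : AuxEqv 𝕜 K u v)
    (h' : AuxEqv 𝕜 L v w) : AuxEqv 𝕜 (K * L) u w := by
  intro F c
  constructor
  · calc _ ≤ K * ‖∑ i ∈ F, c i • v i‖ := (h F c).1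
      _ ≤ K * (L * ‖∑ i ∈ F, c i • w i‖) := by gcongr; exact (h' F c).1
      _ = _ := by ring
  · calc _ ≤ L * ‖∑ i ∈ F, c i • v i‖ := (h' F c).2
      _ ≤ L * (K * ‖∑ i ∈ F, c i • u i‖) := by gcongr; exact (h F c).2
      _ = _ := by ring

theorem AuxEqv.reindex {K : ℝ} {v w : ℕ → E} (h : AuxEqv 𝕜 K v w) (σ : ℕ → ℕ)
    (hσ : Function.Injective σ) : AuxEqv 𝕜 K (v ∘ σ) (w ∘ σ) := by
  intro F c
  have key : ∀ u : ℕ → E, ∑ i ∈ F, c i • (u ∘ σ) i =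
      ∑ i ∈ F.map ⟨σ, hσ⟩, c (Function.invFun σ i) • u i := by
    intro u
    rw [Finset.sum_map]
    apply Finset.sum_congr rfl
    intro i _
    simp [Function.leftInverse_invFun hσ i]
  rw [key v, key w]
  exact h _ _

theorem aux_uniform (z : ℕ → E)
    (hsub : ∀ s : ℕ → ℕ, StrictMono s → ∃ C : ℝ, AuxEqv 𝕜 C (z ∘ s) z) :
    ∃ K : ℝ, 1 ≤ K ∧ ∀ s : ℕ → ℕ, StrictMono s → AuxEqv 𝕜 K (z ∘ s) z := by
  classical
  let sd : (ℕ → ℕ) → ℕ → ℕ := fun d i => ∑ j ∈ Finset.range (i + 1), (d j + 1)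
  have hsd : ∀ d, StrictMono (sd d) := fun d => strictMono_nat_of_lt_succ fun n => by
    simp only [sd]
    rw [Finset.sum_range_succ _ (n + 1)]
    omega
  let A : ℕ → Set (ℕ → ℕ) := fun K => {d | AuxEqv 𝕜 (K : ℝ) (z ∘ sd d) z}
  have hcont : ∀ (F : Finset ℕ) (c : ℕ → 𝕜),
      Continuous fun d : ℕ → ℕ => ‖∑ i ∈ F, c i • z (sd d i)‖ := by
    intro F c
    refine Continuous.norm (continuous_finset_sum _ fun i _ => ?_)
    have h1 : Continuous fun d : ℕ → ℕ => sd d i := by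
      simp only [sd]
      fun_prop
    have h2 : Continuous fun n : ℕ => c i • z n := continuous_of_discreteTopology
    exact h2.comp h1
  have hA : ∀ K, IsClosed (A K) := by
    intro K
    have : A K = ⋂ (F : Finset ℕ), ⋂ (c : ℕ → 𝕜),
        ({d | ‖∑ i ∈ F, c i • z (sd d i)‖ ≤ K * ‖∑ i ∈ F, c i • z i‖} ∩
        {d | ‖∑ i ∈ F, c i • z i‖ ≤ K * ‖∑ i ∈ F, c i • z (sd d i)‖}) := by
      ext d
      simp only [Set.mem_iInter]
      rfl
    rw [this]
    refine isClosed_iInter fun F => isClosed_iInter fun c => ?_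
    exact (isClosed_le (hcont F c) continuous_const).inter
      (isClosed_le continuous_const (continuous_const.mul (hcont F c)))
  have hU : ⋃ K, A K = Set.univ := by
    rw [Set.eq_univ_iff_forall]
    intro d
    obtain ⟨C, hC⟩ := hsub _ (hsd d)
    obtain ⟨K, hK⟩ := exists_nat_ge C
    exact Set.mem_iUnion.2 ⟨K, hC.mono hK⟩
  obtain ⟨K, d0, hd0⟩ := nonempty_interior_of_iUnion_of_closed hA hU
  obtain ⟨I, u, hu, hsubset⟩ := isOpen_pi_iff.1 isOpen_interior d0 hd0
  obtain ⟨N, hN⟩ : ∃ N, ∀ i ∈ I, i < N := ⟨I.sup id + 1, fun i hi =>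
    Nat.lt_succ_of_le (Finset.le_sup (f := id) hi)⟩
  set S := ∑ j ∈ Finset.range N, (d0 j + 1) with hS
  have hshift : ∀ k, ∃ C : ℝ, 0 ≤ C ∧ AuxEqv 𝕜 C (z ∘ (fun l => k + l)) z := by
    intro k
    obtain ⟨C, hC⟩ := hsub (fun l => k + l) (fun a b h => by simpa using h)
    exact ⟨max C 0, le_max_right _ _, hC.mono (le_max_left _ _)⟩
  have hstar : ∀ t : ℕ → ℕ, StrictMono t → S < t 0 →
      AuxEqv 𝕜 (K : ℝ) (z ∘ t) (z ∘ (fun l => N + l)) := by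
    intro t ht ht0
    let t' : ℕ → ℕ := fun j => Nat.casesOn j S t
    let d : ℕ → ℕ := fun i => if i < N then d0 i else t' (i - N + 1) - t' (i - N) - 1
    have ht' : ∀ j, t' j < t' (j + 1) := by
      intro j
      cases j with
      | zero => exact ht0
      | succ j => exact ht (Nat.lt_succ_self j)
    have hdA : d ∈ A K := by
      apply interior_subset
      apply hsubset
      intro i hi
      have : d i = d0 i := if_pos (hN i hi)
      rw [this]
      exact (hu i hi).2
    have hsum : ∀ l, sd d (N + l) = t l := by
      have h0 : ∀ l, ∑ j ∈ Finset.range (N + l), (d j + 1) = t' l := by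
        intro l
        induction l with
        | zero =>
          apply Finset.sum_congr rfl
          intro j hj
          have : d j = d0 j := if_pos (Finset.mem_range.1 hj)
          rw [this]
        | succ l ih =>
          rw [← add_assoc, Finset.sum_range_succ, ih]
          have : d (N + l) = t' (l + 1) - t' l - 1 := by
            simp only [d]
            rw [if_neg (by omega)]
            simp
          rw [this]
          have := ht' l
          omega
      intro l
      exact h0 (l + 1)
    have h1 := AuxEqv.reindex (show AuxEqv 𝕜 (K : ℝ) (z ∘ sd d) z from hdA) (fun l => N + l)
      (fun a b h => by simpa using h)
    have h2 : (z ∘ sd d) ∘ (fun l => N + l) = z ∘ t := by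
      ext l
      simp [hsum]
    rwa [h2] at h1
  obtain ⟨C1, hC1, h1⟩ := hshift N
  obtain ⟨C2, hC2, h2⟩ := hshift (S + 1)
  refine ⟨max 1 (C2 * (K * C1)), le_max_left _ _, fun s hs => ?_⟩
  have h3 := hstar (fun l => S + 1 + s l) (fun a b h => by simpa using hs h) (by omega)
  have h4 : AuxEqv 𝕜 C2 (z ∘ (fun l => S + 1 + s l)) (z ∘ s) := h2.reindex s hs.injective
  exact (h4.swap.comb hC2 (by positivity) (h3.comb (by positivity) hC1 h1)).mono (le_max_right _ _)
end

theorem aux_enum (B : Finset ℕ) : ∃ s : ℕ → ℕ, StrictMono s ∧ (Finset.range B.card).image s = B := by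
  classical
  let s : ℕ → ℕ := fun i => if h : i < B.card then B.orderEmbOfFin rfl ⟨i, h⟩ else B.sup id + 1 + i
  refine ⟨s, ?_, ?_⟩
  · intro i j hij
    simp only [s]
    by_cases hj : j < B.card
    · have hi : i < B.card := hij.trans hj
      rw [dif_pos hi, dif_pos hj]
      exact (B.orderEmbOfFin rfl).strictMono (by simpa using hij)
    · rw [dif_neg hj]
      by_cases hi : i < B.card
      · rw [dif_pos hi]
        have := Finset.le_sup (f := id) (B.orderEmbOfFin_mem rfl ⟨i, hi⟩)
        simp only [id] at this
        omega
      · rw [dif_neg hi]; omega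
  · apply Finset.eq_of_subset_of_card_le
    · intro k hk
      obtain ⟨i, hi, rfl⟩ := Finset.mem_image.1 hk
      simp only [s]
      rw [dif_pos (Finset.mem_range.1 hi)]
      exact B.orderEmbOfFin_mem rfl _
    · rw [Finset.card_image_of_injOn, Finset.card_range]
      intro i hi j hj h
      simp only [Finset.coe_range, Set.mem_Iio] at hi hj
      simp only [s] at h
      rw [dif_pos hi, dif_pos hj] at h
      simpa using (B.orderEmbOfFin rfl).injective h

theorem aux_sign {𝕜 : Type*} [RCLike 𝕜] {E : Type*} [NormedAddCommGroup E] [NormedSpace 𝕜 E]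
    (F : Finset ℕ) (v : ℕ → E) (ε : ℕ → 𝕜) (hε : ∀ k ∈ F, ‖ε k‖ ≤ 1) (R : ℝ)
    (hR : ∀ G ⊆ F, ‖∑ k ∈ G, v k‖ ≤ R) : ‖∑ k ∈ F, ε k • v k‖ ≤ 4 * R := by
  classical
  obtain ⟨g, hg1, hg⟩ := exists_dual_vector'' 𝕜 (∑ k ∈ F, ε k • v k)
  have hsub : ∀ G ⊆ F, ‖∑ k ∈ G, g (v k)‖ ≤ R := by
    intro G hG
    rw [← map_sum]
    calc _ ≤ ‖g‖ * ‖∑ k ∈ G, v k‖ := g.le_opNorm _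
      _ ≤ 1 * ‖∑ k ∈ G, v k‖ := by gcongr
      _ ≤ R := by rw [one_mul]; exact hR G hG
  have habs : ∀ t : ℕ → ℝ, (∀ G ⊆ F, |∑ k ∈ G, t k| ≤ R) → ∑ k ∈ F, |t k| ≤ 2 * R := by
    intro t ht
    rw [← Finset.sum_filter_add_sum_filter_not F (fun k => 0 ≤ t k)]
    have h1 : ∑ k ∈ F with 0 ≤ t k, |t k| = ∑ k ∈ F with 0 ≤ t k, t k :=
      Finset.sum_congr rfl fun k hk => abs_of_nonneg (Finset.mem_filter.1 hk).2
    have h2 : ∑ k ∈ F with ¬ 0 ≤ t k, |t k| = - ∑ k ∈ F with ¬ 0 ≤ t k, t k := by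
      rw [← Finset.sum_neg_distrib]
      exact Finset.sum_congr rfl fun k hk =>
        abs_of_nonpos (not_le.1 (Finset.mem_filter.1 hk).2).le
    rw [h1, h2]
    have h3 := (abs_le.1 (ht _ (Finset.filter_subset (fun k => 0 ≤ t k) F))).2
    have h4 := (abs_le.1 (ht _ (Finset.filter_subset (fun k => ¬ 0 ≤ t k) F))).1
    linarith
  have hre := habs (fun k => RCLike.re (g (v k))) (fun G hG => by
    have := (RCLike.abs_re_le_norm (∑ k ∈ G, g (v k))).trans (hsub G hG)
    simpa only [map_sum] using this)
  have him := habs (fun k => RCLike.im (g (v k))) (fun G hG => by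
    have := (RCLike.abs_im_le_norm (∑ k ∈ G, g (v k))).trans (hsub G hG)
    simpa only [map_sum] using this)
  have h0 : ‖∑ k ∈ F, ε k • v k‖ = ‖g (∑ k ∈ F, ε k • v k)‖ := by
    rw [hg]; simp
  rw [h0, map_sum]
  calc _ ≤ ∑ k ∈ F, ‖g (ε k • v k)‖ := norm_sum_le _ _
    _ ≤ ∑ k ∈ F, (|RCLike.re (g (v k))| + |RCLike.im (g (v k))|) := by
      apply Finset.sum_le_sum
      intro k hk
      rw [map_smul, norm_smul]
      calc _ ≤ 1 * ‖g (v k)‖ := by gcongr; exact hε k hk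
        _ ≤ _ := by 
          rw [one_mul]
          conv_lhs => rw [← RCLike.re_add_im (g (v k))]
          refine (norm_add_le _ _).trans ?_
          rw [norm_mul, RCLike.norm_ofReal, RCLike.norm_ofReal]
          gcongr
          exact mul_le_of_le_one_right (abs_nonneg _) (by rw [RCLike.norm_I]; split_ifs <;> simp)
    _ ≤ 4 * R := by rw [Finset.sum_add_distrib]; linarith

section
variable {𝕜 : Type*} [RCLike 𝕜] {E : Type*} [NormedAddCommGroup E] [NormedSpace 𝕜 E]

theorem aux_proj_le (z : ℕ → E) (a : ℕ → E →L[𝕜] 𝕜)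
    (hbi : ∀ i j, a i (z j) = if i = j then 1 else 0) (K : ℝ)
    (hU : ∀ (F : Finset ℕ) (f : E), ‖∑ n ∈ F, a n f • z n‖ ≤ K * ‖f‖)
    (F G : Finset ℕ) (hFG : F ⊆ G) (c : ℕ → 𝕜) :
    ‖∑ n ∈ F, c n • z n‖ ≤ K * ‖∑ n ∈ G, c n • z n‖ := by
  classical
  have h := hU F (∑ n ∈ G, c n • z n)
  have : ∀ n ∈ F, a n (∑ n ∈ G, c n • z n) • z n = c n • z n := by
    intro n hn
    simp [map_sum, hbi, hFG hn]
  rwa [Finset.sum_congr rfl this] at h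

theorem aux_phi_le (z : ℕ → E) (a : ℕ → E →L[𝕜] 𝕜)
    (hbi : ∀ i j, a i (z j) = if i = j then 1 else 0) (K : ℝ) (hK : 1 ≤ K)
    (hU : ∀ (F : Finset ℕ) (f : E), ‖∑ n ∈ F, a n f • z n‖ ≤ K * ‖f‖)
    (hS : ∀ s : ℕ → ℕ, StrictMono s → AuxEqv 𝕜 K (z ∘ s) z)
    (m : ℕ) (A : Finset ℕ) (hA : A.card ≤ m) (ε : ℕ → 𝕜) (hε : ∀ k ∈ A, ‖ε k‖ = 1) :
    ‖∑ k ∈ A, ε k • z k‖ ≤ 4 * K ^ 2 * ‖∑ k ∈ Finset.range m, z k‖ := by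
  classical
  obtain ⟨s, hs, hsA⟩ := aux_enum A
  have h1 : ∑ k ∈ A, ε k • z k = ∑ j ∈ Finset.range A.card, ε (s j) • (z ∘ s) j := by
    conv_lhs => rw [← hsA]
    rw [Finset.sum_image (hs.injective.injOn)]
    rfl
  have h2 := (hS s hs (Finset.range A.card) (fun j => ε (s j))).1
  have h3 := aux_sign (Finset.range A.card) z (fun j => ε (s j)) (by
    intro k hk
    refine (hε _ ?_).le
    rw [← hsA]
    exact Finset.mem_image_of_mem _ hk) (K * ‖∑ k ∈ Finset.range m, z k‖) (by
    intro G hG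
    have := aux_proj_le z a hbi K hU G (Finset.range m)
      (hG.trans (Finset.range_subset_range.2 hA)) 1
    simpa using this)
  rw [h1]
  calc _ ≤ _ := h2
    _ ≤ K * (4 * (K * ‖∑ k ∈ Finset.range m, z k‖)) := by gcongr
    _ = _ := by ring

theorem aux_dual (z : ℕ → E) (a : ℕ → E →L[𝕜] 𝕜)
    (K : ℝ) (hK : 1 ≤ K)
    (hU : ∀ (F : Finset ℕ) (f : E), ‖∑ n ∈ F, a n f • z n‖ ≤ K * ‖f‖)
    (hS : ∀ s : ℕ → ℕ, StrictMono s → AuxEqv 𝕜 K (z ∘ s) z)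
    (m : ℕ) (B : Finset ℕ) (hB : B.card ≤ m) (f : E) :
    ‖∑ n ∈ B, a n f‖ * ‖∑ k ∈ Finset.range m, z k‖ ≤ 2 * K ^ 3 * m * ‖f‖ := by
  classical
  obtain ⟨B', hBB', hB'⟩ := Infinite.exists_superset_card_eq B m hB
  obtain ⟨s, hs, hsB⟩ := aux_enum B'
  rw [hB'] at hsB
  let c : ℕ → 𝕜 := fun j => if s j ∈ B then a (s j) f else 0
  have hcs : ∑ n ∈ B, a n f = ∑ j ∈ Finset.range m, c j := by
    have h1 : ∑ n ∈ B, a n f = ∑ n ∈ B', if n ∈ B then a n f else 0 := by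
      rw [← Finset.sum_filter, Finset.filter_mem_eq_inter, Finset.inter_eq_right.2 hBB']
    rw [h1, ← hsB, Finset.sum_image (hs.injective.injOn)]
  -- basic estimate
  have hbase : ∀ G : Finset ℕ, ‖∑ j ∈ G, c j • z j‖ ≤ K ^ 2 * ‖f‖ := by
    intro G
    have h1 := (hS s hs G c).2
    have h2 : ∑ j ∈ G, c j • (z ∘ s) j =
        ∑ n ∈ (G.filter (fun j => s j ∈ B)).image s, a n f • z n := by
      rw [Finset.sum_image (hs.injective.injOn), Finset.sum_filter]
      apply Finset.sum_congr rfl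
      intro j _
      simp only [c, Function.comp]
      split_ifs <;> simp
    have h3 := hU ((G.filter (fun j => s j ∈ B)).image s) f
    rw [← h2] at h3
    calc _ ≤ _ := h1
      _ ≤ K * (K * ‖f‖) := by gcongr
      _ = _ := by ring
  have hshift : ∀ r, StrictMono (fun l : ℕ => l + r) := fun r a b h => by simpa using h
  have hup : ∀ r n, ‖∑ j ∈ Finset.range n, c j • z (j + r)‖ ≤ K ^ 3 * ‖f‖ := by
    intro r n
    calc _ ≤ K * ‖∑ j ∈ Finset.range n, c j • z j‖ := (hS _ (hshift r) (Finset.range n) c).1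
      _ ≤ K * (K ^ 2 * ‖f‖) := by gcongr; exact hbase _
      _ = _ := by ring
  have hdown : ∀ r n, ‖∑ i ∈ Finset.range n, c (i + r) • z i‖ ≤ K ^ 3 * ‖f‖ := by
    intro r n
    calc _ ≤ K * ‖∑ i ∈ Finset.range n, c (i + r) • z (i + r)‖ :=
          (hS _ (hshift r) (Finset.range n) (fun i => c (i + r))).2
      _ = K * ‖∑ j ∈ (Finset.range n).image (· + r), c j • z j‖ := by
          rw [Finset.sum_image ((hshift r).injective.injOn)]
      _ ≤ K * (K ^ 2 * ‖f‖) := by gcongr; exact hbase _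
      _ = _ := by ring
  have hprod : (∑ n ∈ B, a n f) • (∑ k ∈ Finset.range m, z k) =
      ∑ p ∈ Finset.range m ×ˢ Finset.range m, c p.1 • z p.2 := by
    rw [hcs, Finset.sum_smul_sum, Finset.sum_product]
  rw [← norm_smul, hprod, ← Finset.sum_filter_add_sum_filter_not _ (fun p : ℕ × ℕ => p.1 ≤ p.2)]
  have hA : ‖∑ p ∈ Finset.range m ×ˢ Finset.range m with p.1 ≤ p.2, c p.1 • z p.2‖
      ≤ m * (K ^ 3 * ‖f‖) := by
    rw [← Finset.sum_fiberwise_of_maps_to (t := Finset.range m) (g := fun p : ℕ × ℕ => p.2 - p.1)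
      (by intro p hp; simp at hp ⊢; omega)]
    have hcard : ∑ _r ∈ Finset.range m, K ^ 3 * ‖f‖ = m * (K ^ 3 * ‖f‖) := by simp
    rw [← hcard]
    refine norm_sum_le_of_le _ fun r hr => ?_
    have : ∑ p ∈ Finset.range m ×ˢ Finset.range m with p.1 ≤ p.2 ∧ p.2 - p.1 = r, c p.1 • z p.2
        = ∑ j ∈ Finset.range (m - r), c j • z (j + r) := by
      refine Finset.sum_nbij' (fun p => p.1) (fun j => (j, j + r)) ?_ ?_ ?_ ?_ ?_
      · intro p hp; simp at hp ⊢; omega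
      · intro j hj; simp at hj ⊢; omega
      · rintro ⟨p, q⟩ hp; simp at hp ⊢; omega
      · intro j hj; rfl
      · rintro ⟨p, q⟩ hp
        simp at hp ⊢
        rw [show p + r = q by omega]
    rw [Finset.filter_filter, this]
    exact hup _ _
  have hBb : ‖∑ p ∈ Finset.range m ×ˢ Finset.range m with ¬ p.1 ≤ p.2, c p.1 • z p.2‖
      ≤ m * (K ^ 3 * ‖f‖) := by
    rw [← Finset.sum_fiberwise_of_maps_to (t := Finset.range m) (g := fun p : ℕ × ℕ => p.1 - p.2)
      (by intro p hp; simp at hp ⊢; omega)]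
    have hcard : ∑ _r ∈ Finset.range m, K ^ 3 * ‖f‖ = m * (K ^ 3 * ‖f‖) := by simp
    rw [← hcard]
    refine norm_sum_le_of_le _ fun r hr => ?_
    by_cases hr0 : r = 0
    · rw [Finset.sum_eq_zero]
      · simp; positivity
      · intro p hp; exfalso; simp at hp; omega
    have : ∑ p ∈ Finset.range m ×ˢ Finset.range m with ¬ p.1 ≤ p.2 ∧ p.1 - p.2 = r, c p.1 • z p.2
        = ∑ j ∈ Finset.range (m - r), c (j + r) • z j := by
      refine Finset.sum_nbij' (fun p => p.2) (fun j => (j + r, j)) ?_ ?_ ?_ ?_ ?_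
      · intro p hp; simp at hp ⊢; omega
      · intro j hj; simp at hj ⊢; omega
      · rintro ⟨p, q⟩ hp; simp at hp ⊢; omega
      · intro j hj; rfl
      · rintro ⟨p, q⟩ hp
        simp at hp ⊢
        rw [show q + r = p by omega]
    rw [Finset.filter_filter, this]
    exact hdown _ _
  refine (norm_add_le _ _).trans ?_
  calc _ ≤ m * (K ^ 3 * ‖f‖) + m * (K ^ 3 * ‖f‖) := add_le_add hA hBb
    _ = _ := by ring
end

theorem aux_num (p q : ℕ → ℝ) (hp : ∀ k, 0 < p k) (hq : ∀ k, 0 < q k)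
    (hp2 : ∀ k, 2 * p k ≤ p (k + 1)) (hq2 : ∀ k, 2 * q k ≤ q (k + 1)) (α : ℕ → ℝ) (m : ℝ)
    (hα0 : ∀ k, 0 ≤ α k) (hα : ∀ k, α k ≤ p k * q k) (hαm : ∀ k, α k ≤ m) (I : Finset ℕ) (K : ℕ) :
    ∑ k ∈ I, α k / q k ≤ 2 * p K + 2 * m / q (K + 1) := by
  classical
  have hm : 0 ≤ m := (hα0 0).trans (hαm 0)
  have h1 : ∀ K, ∑ k ∈ Finset.range (K + 1), p k ≤ 2 * p K := by
    intro K
    induction K with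
    | zero => simp; linarith [hp 0]
    | succ K ih => rw [Finset.sum_range_succ]; linarith [hp2 K]
  have h2 : ∀ c N, ∑ k ∈ Finset.range N, 1 / q (c + k) + 2 / q (c + N) ≤ 2 / q c := by
    intro c N
    induction N with
    | zero => simp
    | succ N ih =>
      rw [Finset.sum_range_succ]
      have : 2 / q (c + (N + 1)) ≤ 1 / q (c + N) := by
        rw [div_le_div_iff₀ (hq _) (hq _)]
        have := hq2 (c + N)
        rw [add_assoc] at this
        linarith
      have h3 : 2 / q (c + N) = 1 / q (c + N) + 1 / q (c + N) := by ring
      linarith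
  obtain ⟨N, hN⟩ : ∃ N, I ⊆ Finset.range (K + 1 + N) := by
    refine ⟨I.sup id + 1, fun i hi => ?_⟩
    have := Finset.le_sup (f := id) hi
    simp only [id] at this
    rw [Finset.mem_range]; omega
  calc ∑ k ∈ I, α k / q k ≤ ∑ k ∈ Finset.range (K + 1 + N), α k / q k :=
        Finset.sum_le_sum_of_subset_of_nonneg hN fun k _ _ => div_nonneg (hα0 k) (hq k).le
    _ = ∑ k ∈ Finset.range (K + 1), α k / q k + ∑ k ∈ Finset.range N, α (K + 1 + k) / q (K + 1 + k) :=
        Finset.sum_range_add _ _ _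
    _ ≤ ∑ k ∈ Finset.range (K + 1), p k + ∑ k ∈ Finset.range N, m * (1 / q (K + 1 + k)) := by
        gcongr with k _ k _
        · rw [div_le_iff₀ (hq k)]; exact hα k
        · rw [mul_one_div]
          exact div_le_div_of_nonneg_right (hαm _) (hq _).le
    _ ≤ 2 * p K + m * (2 / q (K + 1)) := by
        rw [← Finset.mul_sum]
        have := h2 (K + 1) N
        have h4 : 0 < 2 / q (K + 1 + N) := div_pos two_pos (hq _)
        gcongr
        · exact h1 K
        · linarith
    _ = _ := by ring

theorem aux_num2 (φ : ℕ → ℝ) (b : ℕ) (hpos : ∀ m, 0 < m → 0 < φ m) (hmono : Monotone φ)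
    (hL : ∀ m, 0 < m → 2 * φ m ≤ φ (b * m)) (hU : ∀ m, 0 < m → φ (b * m) ≤ ((b : ℝ) / 2) * φ m)
    (hb : 2 ≤ b) (α : ℕ → ℕ) (m : ℕ) (hm : 0 < m) (hα : ∀ k, α k ≤ b ^ k) (hαm : ∀ k, α k ≤ m)
    (I : Finset ℕ) :
    ∑ k ∈ I, (α k : ℝ) * (φ (b ^ k) / (b : ℝ) ^ k) ≤ (b + 2) * φ m ∧
    ∑ k ∈ I, (α k : ℝ) * (φ (b ^ k))⁻¹ ≤ (b + 2) * (m / φ m) := by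
  have hb0 : (0 : ℝ) < b := by positivity
  have hbk : ∀ k, 0 < b ^ k := fun k => by positivity
  have hP : ∀ k, 0 < φ (b ^ k) := fun k => hpos _ (hbk k)
  let p : ℕ → ℝ := fun k => φ (b ^ k)
  let q : ℕ → ℝ := fun k => (b : ℝ) ^ k / φ (b ^ k)
  have hp : ∀ k, 0 < p k := hP
  have hq : ∀ k, 0 < q k := fun k => div_pos (by positivity) (hP k)
  have hp2 : ∀ k, 2 * p k ≤ p (k + 1) := by
    intro k
    simp only [p]
    rw [pow_succ']
    exact hL _ (hbk k)
  have hq2 : ∀ k, 2 * q k ≤ q (k + 1) := by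
    intro k
    simp only [q]
    have h1 := hU _ (hbk k)
    rw [← pow_succ'] at h1
    rw [mul_div_assoc', div_le_div_iff₀ (hP _) (hP _), pow_succ' (b : ℝ)]
    calc 2 * (b : ℝ) ^ k * φ (b ^ (k + 1)) ≤ 2 * (b : ℝ) ^ k * ((b : ℝ) / 2 * φ (b ^ k)) := by gcongr
      _ = _ := by ring
  have hpq : ∀ k, p k * q k = (b : ℝ) ^ k := by
    intro k
    simp only [p, q]
    field_simp [(hP k).ne']
  have hα' : ∀ k, (α k : ℝ) ≤ p k * q k := by
    intro k
    rw [hpq]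
    exact_mod_cast hα k
  have hαm' : ∀ k, (α k : ℝ) ≤ (m : ℝ) := fun k => by exact_mod_cast hαm k
  set K := Nat.log b m with hK
  have hK1 : b ^ K ≤ m := Nat.pow_log_le_self b hm.ne'
  have hK2 : m < b ^ (K + 1) := Nat.lt_pow_succ_log_self hb m
  have hpm := hpos m hm
  have e1 : φ (b ^ K) ≤ φ m := hmono hK1
  have e2 : φ m ≤ φ (b ^ (K + 1)) := hmono hK2.le
  have e3 : φ (b ^ (K + 1)) ≤ (b : ℝ) / 2 * φ (b ^ K) := by
    rw [pow_succ']; exact hU _ (hbk K)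
  have hm' : (0 : ℝ) < m := by exact_mod_cast hm
  have hK1' : (b : ℝ) ^ K ≤ m := by exact_mod_cast hK1
  have hK2' : (m : ℝ) ≤ (b : ℝ) ^ (K + 1) := by exact_mod_cast hK2.le
  constructor
  · have h := aux_num p q hp hq hp2 hq2 (fun k => (α k : ℝ)) m (fun k => Nat.cast_nonneg _) hα' hαm' I K
    have e4 : (m : ℝ) / q (K + 1) ≤ φ (b ^ (K + 1)) := by
      rw [div_le_iff₀ (hq _)]
      have := hpq (K + 1)
      simp only [p] at this
      rw [this]; exact hK2'
    have e5 : 2 * (m : ℝ) / q (K + 1) = 2 * ((m : ℝ) / q (K + 1)) := by ring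
    have e6 : ∀ k, (α k : ℝ) * (φ (b ^ k) / (b : ℝ) ^ k) = (α k : ℝ) / q k := by
      intro k; simp only [q]; rw [div_div_eq_mul_div, mul_div_assoc]
    simp only [e6]
    refine h.trans ?_
    have e7 : p K ≤ φ m := e1
    have e8 : (b : ℝ) / 2 * φ (b ^ K) ≤ (b : ℝ) / 2 * φ m := by gcongr
    rw [e5]
    linarith
  · have h := aux_num q p hq hp hq2 hp2 (fun k => (α k : ℝ)) m (fun k => Nat.cast_nonneg _)
      (fun k => by rw [mul_comm]; exact hα' k) hαm' I K
    simp only [← div_eq_mul_inv]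
    refine h.trans ?_
    have e4 : q K ≤ (b : ℝ) / 2 * (m / φ m) := by
      simp only [q]
      rw [div_le_iff₀ (hP K)]
      calc (b : ℝ) ^ K ≤ m := hK1'
        _ = (m / φ m) * φ m := by field_simp
        _ ≤ (m / φ m) * ((b : ℝ) / 2 * φ (b ^ K)) := by gcongr; linarith
        _ = _ := by ring
    have e5 : (m : ℝ) / p (K + 1) ≤ m / φ m := by
      simp only [p]
      gcongr
    have e6 : 2 * (m : ℝ) / p (K + 1) = 2 * ((m : ℝ) / p (K + 1)) := by ring
    rw [e6]
    linarith

theorem aux_blocks (b : ℕ) (hb : 0 < b) : ∃ (D : ℕ → Finset ℕ) (blk : ℕ → ℕ),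
    (∀ i k, i ∈ D k ↔ blk i = k) ∧ (∀ k, (D k).card = b ^ k) ∧
    (∀ k l, k < l → ∀ i ∈ D k, ∀ j ∈ D l, i < j) := by
  let o : ℕ → ℕ := fun k => ∑ j ∈ Finset.range k, b ^ j
  have ho : StrictMono o := strictMono_nat_of_lt_succ fun k => by
    simp only [o, Finset.sum_range_succ]
    have : 0 < b ^ k := by positivity
    omega
  have hex : ∀ i, ∃ k, o k ≤ i ∧ i < o (k + 1) := by
    intro i
    induction i with
    | zero =>
      refine ⟨0, by simp [o], ?_⟩
      simp [o]
    | succ i ih =>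
      obtain ⟨k, h1, h2⟩ := ih
      by_cases h : i + 1 < o (k + 1)
      · exact ⟨k, by omega, h⟩
      · refine ⟨k + 1, by omega, ?_⟩
        have := ho (Nat.lt_succ_self (k + 1))
        simp only [Nat.succ_eq_add_one] at this
        omega
  choose blk h1 h2 using hex
  have horder : ∀ k l, k < l → ∀ i ∈ Finset.Ico (o k) (o (k + 1)),
      ∀ j ∈ Finset.Ico (o l) (o (l + 1)), i < j := by
    intro k l hkl i hi j hj
    rw [Finset.mem_Ico] at hi hj
    have := ho.monotone (show k + 1 ≤ l from hkl)
    omega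
  refine ⟨fun k => Finset.Ico (o k) (o (k + 1)), blk, ?_, ?_, horder⟩
  · intro i k
    have hi : i ∈ Finset.Ico (o (blk i)) (o (blk i + 1)) := Finset.mem_Ico.2 ⟨h1 i, h2 i⟩
    constructor
    · intro h
      rcases lt_trichotomy (blk i) k with hlt | heq | hgt
      · exact absurd (horder _ _ hlt i hi i h) (lt_irrefl _)
      · exact heq
      · exact absurd (horder _ _ hgt i h i hi) (lt_irrefl _)
    · rintro rfl
      exact hi
  · intro k
    simp [o, Finset.sum_range_succ]

theorem aux_main {𝕜 : Type*} [RCLike 𝕜] {X : Type*} [NormedAddCommGroup X] [NormedSpace 𝕜 X]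
    (φ : ℕ → ℝ) (b : ℕ) (hpos : ∀ m, 0 < m → 0 < φ m) (hmono : Monotone φ)
    (hL : ∀ m, 0 < m → 2 * φ m ≤ φ (b * m)) (hU : ∀ m, 0 < m → φ (b * m) ≤ ((b : ℝ) / 2) * φ m)
    (hb : 2 ≤ b)
    (x w : ℕ → X) (xs ws : ℕ → X →L[𝕜] 𝕜)
    (hxx : ∀ n k, xs n (x k) = if n = k then 1 else 0) (hxw : ∀ n k, xs n (w k) = 0)
    (hwx : ∀ n k, ws n (x k) = 0) (hww : ∀ n k, ws n (w k) = if n = k then 1 else 0)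
    (hdense : Dense (Submodule.span 𝕜 (Set.range x ∪ Set.range w) : Set X))
    (htotal : ∀ f : X, (∀ n, xs n f = 0) → (∀ n, ws n f = 0) → f = 0)
    (C : ℝ) (hx : ∀ n, ‖x n‖ ≤ C) (hxs : ∀ n, ‖xs n‖ ≤ C)
    (hw : ∀ (m : ℕ) (A : Finset ℕ), A.card ≤ m → ‖∑ n ∈ A, w n‖ ≤ C * φ m)
    (hws : ∀ (m : ℕ) (A : Finset ℕ), A.card ≤ m → ‖∑ n ∈ A, ws n‖ * φ m ≤ C * m) :
    ∃ (y : ℕ → X) (ys : ℕ → X →L[𝕜] 𝕜),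
      Dense (Submodule.span 𝕜 (Set.range y) : Set X) ∧
      (∀ n k, ys n (y k) = if n = k then 1 else 0) ∧
      (∀ f : X, (∀ n, ys n f = 0) → f = 0) ∧
      (∃ C : ℝ, 1 ≤ C ∧ ∀ (m : ℕ) (A B : Finset ℕ), A.card ≤ m → B.card ≤ m →
        ‖∑ n ∈ A, y n‖ * ‖∑ n ∈ B, ys n‖ ≤ C * m) ∧
      (∃ (B : ℕ → Finset ℕ) (a : ℕ → 𝕜),
        (∀ k, (B k).Nonempty) ∧
        (∀ k, ∀ i ∈ B k, ∀ j ∈ B (k + 1), i < j) ∧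
        (∀ k, x k = ∑ n ∈ B k, a n • y n)) := by
  classical
  obtain ⟨D, blk, hD, hDc, hDo⟩ := aux_blocks b (by omega)
  have hC : 0 ≤ C := (norm_nonneg _).trans (hx 0)
  have hbk : ∀ k, 0 < b ^ k := fun k => by positivity
  have hP : ∀ k, 0 < φ (b ^ k) := fun k => hpos _ (hbk k)
  let ν : ℕ → 𝕜 := fun k => ((b ^ k : ℕ) : 𝕜)
  let π : ℕ → 𝕜 := fun k => ((φ (b ^ k) : ℝ) : 𝕜)
  have hν : ∀ k, ν k ≠ 0 := fun k => by
    simp only [ν]; exact_mod_cast (hbk k).ne'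
  have hπ : ∀ k, π k ≠ 0 := fun k => by
    simp only [π]; exact_mod_cast (hP k).ne'
  have hνn : ∀ k, ‖ν k‖ = (b : ℝ) ^ k := fun k => by
    simp only [ν]; rw [RCLike.norm_natCast]; push_cast; rfl
  have hπn : ∀ k, ‖π k‖ = φ (b ^ k) := fun k => by
    simp only [π]; rw [RCLike.norm_ofReal, abs_of_pos (hP k)]
  let W : ℕ → X := fun k => ∑ i ∈ D k, w i
  let Ws : ℕ → X →L[𝕜] 𝕜 := fun k => ∑ i ∈ D k, ws i
  have hwW : ∀ i k, ws i (W k) = if blk i = k then 1 else 0 := by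
    intro i k
    simp only [W, map_sum, hww, Finset.sum_ite_eq, hD]
  have hWw : ∀ k i, Ws k (w i) = if blk i = k then 1 else 0 := by
    intro k i
    simp only [Ws, FunLike.coe_sum, Finset.sum_apply, hww, Finset.sum_ite_eq', hD]
  have hWW : ∀ k l, Ws k (W l) = if k = l then ν k else 0 := by
    intro k l
    have h1 : Ws k (W l) = ∑ i ∈ D l, if blk i = k then (1 : 𝕜) else 0 := by
      simp only [W, map_sum, hWw]
    have h2 : ∀ i ∈ D l, (if blk i = k then (1 : 𝕜) else 0) = if k = l then 1 else 0 := by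
      intro i hi
      rw [(hD i l).1 hi]
      simp only [eq_comm]
    rw [h1, Finset.sum_congr rfl h2, Finset.sum_const, hDc]
    split_ifs with h
    · subst h; simp [ν]
    · simp
  have hxW : ∀ n k, xs n (W k) = 0 := by
    intro n k; simp [W, map_sum, hxw]
  have hWx : ∀ k n, Ws k (x n) = 0 := by
    intro k n; simp [Ws, hwx]
  have hWn : ∀ k, ‖W k‖ ≤ C * φ (b ^ k) := fun k => hw _ _ (hDc k).le
  have hWsn : ∀ k, ‖Ws k‖ ≤ C * ((b : ℝ) ^ k / φ (b ^ k)) := fun k => by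
    have := hws _ _ (hDc k).le
    rw [mul_div_assoc', le_div_iff₀ (hP k)]
    simpa using this
  let x' : ℕ → X := fun k => if k % 2 = 0 then x (k / 2) else (π (k / 2))⁻¹ • W (k / 2)
  let xs' : ℕ → X →L[𝕜] 𝕜 := fun k =>
    if k % 2 = 0 then xs (k / 2) else (π (k / 2) / ν (k / 2)) • Ws (k / 2)
  have hx'n : ∀ k, ‖x' k‖ ≤ C := by
    intro k
    simp only [x']
    split_ifs with h
    · exact hx _
    · rw [norm_smul, norm_inv, hπn, inv_mul_le_iff₀ (hP _), mul_comm]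
      exact hWn _
  have hxs'n : ∀ k, ‖xs' k‖ ≤ C := by
    intro k
    simp only [xs']
    split_ifs with h
    · exact hxs _
    · rw [norm_smul, norm_div, hπn, hνn]
      have h0 := hP (k / 2)
      calc _ ≤ φ (b ^ (k / 2)) / (b : ℝ) ^ (k / 2) * (C * ((b : ℝ) ^ (k / 2) / φ (b ^ (k / 2)))) := by
            gcongr; exact hWsn _
        _ = C := by
            have : (b : ℝ) ≠ 0 := by positivity
            field_simp
  let Q : ℕ → X := fun i => w i - (ν (blk i))⁻¹ • W (blk i)
  let Qs : ℕ → X →L[𝕜] 𝕜 := fun i => ws i - (ν (blk i))⁻¹ • Ws (blk i)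
  have hQsx' : ∀ i l, Qs i (x' l) = 0 := by
    intro i l
    simp only [Qs, x', sub_apply, smul_apply, smul_eq_mul]
    split_ifs with h
    · simp [hwx, hWx]
    · rw [map_smul, map_smul, hwW, hWW]
      split_ifs with h2
      · simp only [smul_eq_mul]
        have := hν (blk i)
        field_simp
        simp
      · simp
  have hxs'Q : ∀ k i, xs' k (Q i) = 0 := by
    intro k i
    simp only [Q, xs']
    split_ifs with h
    · simp [hxw, hxW]
    · rw [smul_apply, map_sub, map_smul, hWw, hWW]
      by_cases h2 : blk i = k / 2
      · rw [if_pos h2, if_pos h2.symm, h2]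
        simp [hν]
      · rw [if_neg h2, if_neg (Ne.symm h2)]
        simp
  have hQQ : ∀ i j, Qs i (Q j) = (if i = j then 1 else 0) - (if blk i = blk j then (ν (blk j))⁻¹ else 0) := by
    intro i j
    simp only [Qs, Q, sub_apply, smul_apply, smul_eq_mul, map_sub, map_smul]
    rw [hww, hwW, hWw, hWW]
    by_cases h : blk i = blk j
    · simp [h, hν]
    · simp [h, Ne.symm h]
  have hxx' : ∀ k l, xs' k (x' l) = if k = l then 1 else 0 := by
    intro k l
    simp only [x', xs']
    split_ifs with h1 h2 h3 h3 h2 h3 h3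
    · rw [hxx, if_pos (by omega)]
    · rw [hxx, if_neg (by omega)]
    · omega
    · simp [hxW]
    · omega
    · simp [hWx]
    · rw [smul_apply, map_smul, hWW, if_pos (by omega), h3]
      have := hν (l / 2)
      have := hπ (l / 2)
      simp only [smul_eq_mul]
      field_simp
    · rw [smul_apply, map_smul, hWW, if_neg (by omega)]
      simp
  let y : ℕ → X := fun i => Q i + (π (blk i) / ν (blk i)) • x' (blk i)
  let ys : ℕ → X →L[𝕜] 𝕜 := fun i => Qs i + (π (blk i))⁻¹ • xs' (blk i)
  have hbiorth : ∀ n k, ys n (y k) = if n = k then 1 else 0 := by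
    intro i j
    simp only [y, ys, add_apply, smul_apply, map_add, map_smul, smul_eq_mul]
    rw [hQsx', hxs'Q, hQQ, hxx']
    by_cases h : blk i = blk j
    · have := hν (blk j)
      have := hπ (blk j)
      simp only [h, if_true]
      field_simp
      ring
    · simp [h]
  have hsumQ : ∀ k, ∑ i ∈ D k, Q i = 0 := by
    intro k
    simp only [Q, Finset.sum_sub_distrib]
    rw [Finset.sum_congr rfl (f := fun i => (ν (blk i))⁻¹ • W (blk i)) (g := fun _ => (ν k)⁻¹ • W k)
      (fun i hi => by rw [(hD i k).1 hi]), Finset.sum_const, hDc, ← Nat.cast_smul_eq_nsmul 𝕜, smul_smul]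
    have : ((b ^ k : ℕ) : 𝕜) * (ν k)⁻¹ = 1 := mul_inv_cancel₀ (hν k)
    rw [this, one_smul]
    simp [W]
  have hsumQs : ∀ k, ∑ i ∈ D k, Qs i = 0 := by
    intro k
    simp only [Qs, Finset.sum_sub_distrib]
    rw [Finset.sum_congr rfl (f := fun i => (ν (blk i))⁻¹ • Ws (blk i)) (g := fun _ => (ν k)⁻¹ • Ws k)
      (fun i hi => by rw [(hD i k).1 hi]), Finset.sum_const, hDc, ← Nat.cast_smul_eq_nsmul 𝕜, smul_smul]
    have : ((b ^ k : ℕ) : 𝕜) * (ν k)⁻¹ = 1 := mul_inv_cancel₀ (hν k)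
    rw [this, one_smul]
    simp [Ws]
  have hsumy : ∀ k, ∑ i ∈ D k, y i = π k • x' k := by
    intro k
    simp only [y, Finset.sum_add_distrib, hsumQ]
    rw [Finset.sum_congr rfl (g := fun _ => (π k / ν k) • x' k)
      (fun i hi => by rw [(hD i k).1 hi]), Finset.sum_const, hDc, ← Nat.cast_smul_eq_nsmul 𝕜, smul_smul]
    have : ((b ^ k : ℕ) : 𝕜) * (π k / ν k) = π k := mul_div_cancel₀ _ (hν k)
    rw [this, zero_add]
  have hsumys : ∀ k, ∑ i ∈ D k, ys i = (ν k / π k) • xs' k := by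
    intro k
    simp only [ys, Finset.sum_add_distrib, hsumQs]
    rw [Finset.sum_congr rfl (g := fun _ => (π k)⁻¹ • xs' k)
      (fun i hi => by rw [(hD i k).1 hi]), Finset.sum_const, hDc, ← Nat.cast_smul_eq_nsmul 𝕜, smul_smul]
    rw [zero_add, div_eq_mul_inv]
  have hx'y : ∀ k, x' k = ∑ i ∈ D k, (π (blk i))⁻¹ • y i := by
    intro k
    rw [Finset.sum_congr rfl (g := fun i => (π k)⁻¹ • y i)
      (fun i hi => by rw [(hD i k).1 hi]), ← Finset.smul_sum, hsumy, smul_smul,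
      inv_mul_cancel₀ (hπ k), one_smul]
  have hx'even : ∀ k, x' (2 * k) = x k := by
    intro k; simp [x']
  have hx'odd : ∀ k, x' (2 * k + 1) = (π k)⁻¹ • W k := by
    intro k
    simp only [x']
    rw [if_neg (by omega), show (2 * k + 1) / 2 = k by omega]
  have hxs'even : ∀ k, xs' (2 * k) = xs k := by
    intro k; simp [xs']
  have hxs'odd : ∀ k, xs' (2 * k + 1) = (π k / ν k) • Ws k := by
    intro k
    simp only [xs']
    rw [if_neg (by omega), show (2 * k + 1) / 2 = k by omega]
  -- sums over blocks
  have hblocksum : ∀ (A : Finset ℕ) (g : ℕ → ℝ), ∑ i ∈ A, g (blk i) =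
      ∑ k ∈ A.image blk, ((A.filter (fun i => blk i = k)).card : ℝ) * g k := by
    intro A g
    rw [← Finset.sum_fiberwise_of_maps_to (t := A.image blk) (g := blk)
      (fun i hi => Finset.mem_image_of_mem _ hi)]
    apply Finset.sum_congr rfl
    intro k _
    rw [Finset.sum_congr rfl (g := fun _ => g k)
      (fun i hi => by rw [(Finset.mem_filter.1 hi).2]), Finset.sum_const, nsmul_eq_mul]
  have hcnt : ∀ (A : Finset ℕ) k, (A.filter (fun i => blk i = k)).card ≤ b ^ k := by
    intro A k
    rw [← hDc k]
    apply Finset.card_le_card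
    intro i hi
    exact (hD i k).2 (Finset.mem_filter.1 hi).2
  have hyn : ∀ m, 0 < m → ∀ A : Finset ℕ, A.card ≤ m →
      ‖∑ i ∈ A, y i‖ ≤ (C + 2 * C * (b + 2)) * φ m := by
    intro m hm A hA
    have h1 : ∑ i ∈ A, y i = ∑ i ∈ A, w i +
        ∑ i ∈ A, ((π (blk i) / ν (blk i)) • x' (blk i) - (ν (blk i))⁻¹ • W (blk i)) := by
      rw [← Finset.sum_add_distrib]
      apply Finset.sum_congr rfl
      intro i _
      simp only [y, Q]
      abel
    have h2 : ∀ k, ‖(π k / ν k) • x' k - (ν k)⁻¹ • W k‖ ≤ 2 * C * (φ (b ^ k) / (b : ℝ) ^ k) := by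
      intro k
      refine (norm_sub_le _ _).trans ?_
      rw [norm_smul, norm_smul, norm_div, norm_inv, hπn, hνn]
      have h0 := hP k
      calc _ ≤ φ (b ^ k) / (b : ℝ) ^ k * C + ((b : ℝ) ^ k)⁻¹ * (C * φ (b ^ k)) := by
            gcongr
            · exact hx'n k
            · exact hWn k
        _ = _ := by ring
    rw [h1]
    refine (norm_add_le _ _).trans ?_
    have h3 := (norm_sum_le A fun i =>
      ((π (blk i) / ν (blk i)) • x' (blk i) - (ν (blk i))⁻¹ • W (blk i))).trans
      (Finset.sum_le_sum fun i _ => h2 (blk i))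
    rw [← Finset.mul_sum, hblocksum A (fun k => φ (b ^ k) / (b : ℝ) ^ k)] at h3
    have h4 := (aux_num2 φ b hpos hmono hL hU hb
      (fun k => (A.filter (fun i => blk i = k)).card) m hm (hcnt A)
      (fun k => (Finset.card_filter_le _ _).trans hA) (A.image blk)).1
    have h5 := hw m A hA
    have h6 := mul_le_mul_of_nonneg_left h4 (show 0 ≤ 2 * C by positivity)
    linarith
  have hysn : ∀ m, 0 < m → ∀ A : Finset ℕ, A.card ≤ m →
      ‖∑ i ∈ A, ys i‖ ≤ (C + 2 * C * (b + 2)) * (m / φ m) := by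
    intro m hm A hA
    have h1 : ∑ i ∈ A, ys i = ∑ i ∈ A, ws i +
        ∑ i ∈ A, ((π (blk i))⁻¹ • xs' (blk i) - (ν (blk i))⁻¹ • Ws (blk i)) := by
      rw [← Finset.sum_add_distrib]
      apply Finset.sum_congr rfl
      intro i _
      simp only [ys, Qs]
      abel
    have h2 : ∀ k, ‖(π k)⁻¹ • xs' k - (ν k)⁻¹ • Ws k‖ ≤ 2 * C * (φ (b ^ k))⁻¹ := by
      intro k
      refine (norm_sub_le _ _).trans ?_
      rw [norm_smul, norm_smul, norm_inv, norm_inv, hπn, hνn]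
      have h0 := hP k
      calc _ ≤ (φ (b ^ k))⁻¹ * C + ((b : ℝ) ^ k)⁻¹ * (C * ((b : ℝ) ^ k / φ (b ^ k))) := by
            gcongr
            · exact hxs'n k
            · exact hWsn k
        _ = _ := by
            have : (b : ℝ) ≠ 0 := by positivity
            field_simp
            ring
    rw [h1]
    refine (norm_add_le _ _).trans ?_
    have h3 := (norm_sum_le A fun i =>
      ((π (blk i))⁻¹ • xs' (blk i) - (ν (blk i))⁻¹ • Ws (blk i))).trans
      (Finset.sum_le_sum fun i _ => h2 (blk i))
    rw [← Finset.mul_sum, hblocksum A (fun k => (φ (b ^ k))⁻¹)] at h3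
    have h4 := (aux_num2 φ b hpos hmono hL hU hb
      (fun k => (A.filter (fun i => blk i = k)).card) m hm (hcnt A)
      (fun k => (Finset.card_filter_le _ _).trans hA) (A.image blk)).2
    have h5 : ‖∑ i ∈ A, ws i‖ ≤ C * (m / φ m) := by
      rw [mul_div_assoc', le_div_iff₀ (hpos m hm)]
      exact hws m A hA
    have h6 := mul_le_mul_of_nonneg_left h4 (show 0 ≤ 2 * C by positivity)
    linarith
  refine ⟨y, ys, ?_, hbiorth, ?_, ?_, ?_⟩
  · -- density
    have hymem : ∀ i, y i ∈ Submodule.span 𝕜 (Set.range y) := fun i =>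
      Submodule.subset_span ⟨i, rfl⟩
    have hx'mem : ∀ k, x' k ∈ Submodule.span 𝕜 (Set.range y) := fun k => by
      rw [hx'y]
      exact Submodule.sum_mem _ fun i _ => Submodule.smul_mem _ _ (hymem i)
    have hWmem : ∀ k, W k ∈ Submodule.span 𝕜 (Set.range y) := fun k => by
      have h := Submodule.smul_mem _ (π k) (hx'mem (2 * k + 1))
      rwa [hx'odd, smul_smul, mul_inv_cancel₀ (hπ k), one_smul] at h
    have hwmem : ∀ i, w i ∈ Submodule.span 𝕜 (Set.range y) := fun i => by
      have h : w i = y i - (π (blk i) / ν (blk i)) • x' (blk i) + (ν (blk i))⁻¹ • W (blk i) := by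
        simp only [y, Q]; abel
      rw [h]
      exact Submodule.add_mem _ (Submodule.sub_mem _ (hymem i)
        (Submodule.smul_mem _ _ (hx'mem _))) (Submodule.smul_mem _ _ (hWmem _))
    refine hdense.mono ?_
    rw [SetLike.coe_subset_coe, Submodule.span_le]
    rintro v (⟨k, rfl⟩ | ⟨k, rfl⟩)
    · have := hx'mem (2 * k)
      rwa [hx'even] at this
    · exact hwmem k
  · intro f hf
    have h1 : ∀ k, xs' k f = 0 := by
      intro k
      have h : (∑ i ∈ D k, ys i) f = 0 := by
        simp [hf]
      rw [hsumys, smul_apply, smul_eq_mul, mul_eq_zero] at h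
      exact h.resolve_left (div_ne_zero (hν k) (hπ k))
    have h2 : ∀ k, Ws k f = 0 := by
      intro k
      have h := h1 (2 * k + 1)
      rw [hxs'odd, smul_apply, smul_eq_mul, mul_eq_zero] at h
      exact h.resolve_left (div_ne_zero (hπ k) (hν k))
    apply htotal
    · intro n
      rw [← hxs'even]; exact h1 _
    · intro n
      have h := hf n
      simp only [ys, Qs, add_apply, sub_apply, smul_apply, h1, h2] at h
      simpa using h
  · refine ⟨max 1 ((C + 2 * C * (b + 2)) ^ 2), le_max_left _ _, ?_⟩
    intro m A B hA hB
    rcases Nat.eq_zero_or_pos m with rfl | hm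
    · have : A = ∅ := by simpa using hA
      simp [this]
    · have h1 := hyn m hm A hA
      have h2 := hysn m hm B hB
      have h3 := hpos m hm
      calc _ ≤ ((C + 2 * C * (b + 2)) * φ m) * ((C + 2 * C * (b + 2)) * (m / φ m)) := by
            gcongr
        _ = (C + 2 * C * (b + 2)) ^ 2 * m := by field_simp
        _ ≤ _ := by gcongr; exact le_max_right _ _
  · refine ⟨fun k => D (2 * k), fun i => (π (blk i))⁻¹, ?_, ?_, ?_⟩
    · intro k
      rw [← Finset.card_pos, hDc]
      exact hbk _
    · intro k i hi j hj
      exact hDo _ _ (by omega) i hi j hj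
    · intro k
      rw [← hx'even, hx'y]

section
variable {𝕜 : Type*} [RCLike 𝕜] {E : Type*} [NormedAddCommGroup E] [NormedSpace 𝕜 E]

theorem aux_summable [CompleteSpace E] {v w : ℕ → E} (K : ℝ) (hK : 0 < K) (hv : Summable v)
    (h : ∀ F : Finset ℕ, ‖∑ n ∈ F, w n‖ ≤ K * ‖∑ n ∈ F, v n‖) : Summable w := by
  rw [summable_iff_vanishing_norm] at hv ⊢
  intro ε hε
  obtain ⟨s, hs⟩ := hv (ε / K) (by positivity)
  refine ⟨s, fun t ht => (h t).trans_lt ?_⟩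
  have := hs t ht
  rw [lt_div_iff₀ hK] at this
  linarith

theorem aux_mk [CompleteSpace E] (c : ℕ → E →L[𝕜] 𝕜) (w : ℕ → E)
    (h : ∀ f, Summable fun n => c n f • w n) :
    ∃ T : E →L[𝕜] E, ∀ f, HasSum (fun n => c n f • w n) (T f) := by
  have key : Tendsto (fun (N : ℕ) (f : E) => (∑ n ∈ Finset.range N, (c n).smulRight (w n)) f) atTop
      (𝓝 fun f => ∑' n, c n f • w n) := by
    rw [tendsto_pi_nhds]
    intro f
    have := (h f).hasSum.tendsto_sum_nat
    simpa [sum_apply] using this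
  refine ⟨continuousLinearMapOfTendsto (fun N => ∑ n ∈ Finset.range N, (c n).smulRight (w n)) key, ?_⟩
  intro f
  exact (h f).hasSum

theorem aux_Z [CompleteSpace E] (z : ℕ → E)
    (hSchauder : ∀ f : E, ∃! a : ℕ → 𝕜,
      Tendsto (fun N => ∑ n ∈ Finset.range N, a n • z n) atTop (𝓝 f))
    (hUncond : ∀ (f : E) (a : ℕ → 𝕜),
      Tendsto (fun N => ∑ n ∈ Finset.range N, a n • z n) atTop (𝓝 f) →
      HasSum (fun n => a n • z n) f)
    (hsub : ∀ s : ℕ → ℕ, StrictMono s → ∃ C, AuxEqv 𝕜 C (z ∘ s) z) :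
    ∃ (a : ℕ → E →L[𝕜] 𝕜) (T R : E →L[𝕜] E) (K : ℝ), 1 ≤ K ∧
      (∀ i j, a i (z j) = if i = j then 1 else 0) ∧
      (∀ f, HasSum (fun n => a n f • z n) f) ∧
      (∀ f, R (T f) = f) ∧
      (∀ k, T (z k) = z (2 * k)) ∧
      (∀ k, R (z (2 * k + 1)) = 0) ∧
      (∀ k f, a k (R f) = a (2 * k) f) ∧
      (∀ k f, a (2 * k + 1) (T f) = 0) ∧
      (∀ (m : ℕ) (A : Finset ℕ), A.card ≤ m → ∀ ε : ℕ → 𝕜, (∀ k ∈ A, ‖ε k‖ = 1) →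
        ‖∑ k ∈ A, ε k • z k‖ ≤ 4 * K ^ 2 * ‖∑ k ∈ Finset.range m, z k‖) ∧
      (∀ (m : ℕ) (B : Finset ℕ), B.card ≤ m → ∀ f,
        ‖∑ n ∈ B, a n f‖ * ‖∑ k ∈ Finset.range m, z k‖ ≤ 2 * K ^ 3 * m * ‖f‖) := by
  classical
  obtain ⟨a, hbi, hexp⟩ := aux_coord z hSchauder
  obtain ⟨K₁, hK₁, hS₁⟩ := aux_uniform (𝕜 := 𝕜) z hsub
  have hsum : ∀ f, HasSum (fun n => a n f • z n) f := fun f => hUncond f _ (hexp f)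
  let bas : UnconditionalSchauderBasis ℕ 𝕜 E :=
    { basis := z
      coord := a
      ortho := fun i j => by rw [hbi]; simp [Pi.single_apply]
      expansion := hsum }
  obtain ⟨K₂, hK₂⟩ := bas.exists_norm_proj_le
  have hU₂ : ∀ (F : Finset ℕ) (f : E), ‖∑ n ∈ F, a n f • z n‖ ≤ K₂ * ‖f‖ := by
    intro F f
    have h := (bas.proj F).le_of_opNorm_le (hK₂ F) f
    rwa [GeneralSchauderBasis.proj_apply] at h
  let K := max K₁ K₂
  have hK : 1 ≤ K := hK₁.trans (le_max_left _ _)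
  have hU : ∀ (F : Finset ℕ) (f : E), ‖∑ n ∈ F, a n f • z n‖ ≤ K * ‖f‖ := fun F f =>
    (hU₂ F f).trans (by gcongr; exact le_max_right _ _)
  have hS : ∀ s : ℕ → ℕ, StrictMono s → AuxEqv 𝕜 K (z ∘ s) z := fun s hs =>
    (hS₁ s hs).mono (le_max_left _ _)
  have h2 : StrictMono fun n : ℕ => 2 * n := fun i j h => by
    show 2 * i < 2 * j
    omega
  obtain ⟨T, hT⟩ := aux_mk (fun n => a n) (fun n => z (2 * n)) (fun f =>
    aux_summable K (by linarith) (hsum f).summable (fun F => (hS _ h2 F (fun n => a n f)).1))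
  obtain ⟨R, hR⟩ := aux_mk (fun n => a (2 * n)) (fun n => z n) (fun f =>
    aux_summable K (by linarith) ((hsum f).summable.comp_injective h2.injective)
      (fun F => (hS _ h2 F (fun n => a (2 * n) f)).2))
  have hRz : ∀ k, R (z (2 * k)) = z k := by
    intro k
    refine (hR _).unique ?_
    have : (fun n => a (2 * n) (z (2 * k)) • z n) = fun n => if n = k then z k else 0 := by
      funext n
      rw [hbi]
      by_cases h : n = k
      · simp [h]
      · rw [if_neg (by omega), if_neg h, zero_smul]
    rw [this]
    exact hasSum_ite_eq _ _
  have hRz' : ∀ k, R (z (2 * k + 1)) = 0 := by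
    intro k
    refine (hR _).unique ?_
    have : (fun n => a (2 * n) (z (2 * k + 1)) • z n) = fun n => 0 := by
      funext n
      rw [hbi, if_neg (by omega), zero_smul]
    rw [this]
    exact hasSum_zero
  have hTz : ∀ k, T (z k) = z (2 * k) := by
    intro k
    refine (hT _).unique ?_
    have : (fun n => a n (z k) • z (2 * n)) = fun n => if n = k then z (2 * k) else 0 := by
      funext n
      rw [hbi]
      by_cases h : n = k
      · simp [h]
      · rw [if_neg h, if_neg h, zero_smul]
    rw [this]
    exact hasSum_ite_eq _ _
  refine ⟨a, T, R, K, hK, hbi, hsum, ?_, hTz, hRz', ?_, ?_, ?_, ?_⟩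
  · intro f
    have h := R.hasSum (hT f)
    have h' : (fun n => R (a n f • z (2 * n))) = fun n => a n f • z n := by
      funext n
      rw [map_smul, hRz]
    have h3 := h' ▸ h
    exact h3.unique (hsum f)
  · intro k f
    have h := (a k).hasSum (hR f)
    refine h.unique ?_
    have h' : (fun n => a k (a (2 * n) f • z n)) = fun n => if n = k then a (2 * k) f else 0 := by
      funext n
      rw [map_smul, hbi]
      by_cases h : n = k
      · simp [h]
      · rw [if_neg (Ne.symm h), if_neg h, smul_zero]
    rw [h']
    exact hasSum_ite_eq _ _
  · intro k f
    have h := (a (2 * k + 1)).hasSum (hT f)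
    refine h.unique ?_
    have h' : (fun n => a (2 * k + 1) (a n f • z (2 * n))) = fun n => 0 := by
      funext n
      rw [map_smul, hbi, if_neg (by omega), smul_zero]
    rw [h']
    exact hasSum_zero
  · intro m A hA ε hε
    exact aux_phi_le z a hbi K hK hU hS m A hA ε hε
  · intro m B hB f
    exact aux_dual z a K hK hU hS m B hB f

theorem aux_eqv (z w : ℕ → E)
    (T : (Submodule.span 𝕜 (Set.range z)).topologicalClosure ≃L[𝕜]
            (Submodule.span 𝕜 (Set.range w)).topologicalClosure)
    (hT : ∀ k, (T ⟨z k, Submodule.le_topologicalClosure _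
                (Submodule.subset_span ⟨k, rfl⟩)⟩ : E) = w k) :
    ∃ C, AuxEqv 𝕜 C w z := by
  refine ⟨max ‖T.toContinuousLinearMap‖ ‖T.symm.toContinuousLinearMap‖, ?_⟩
  intro F c
  let zz : ℕ → (Submodule.span 𝕜 (Set.range z)).topologicalClosure := fun k =>
    ⟨z k, Submodule.le_topologicalClosure _ (Submodule.subset_span ⟨k, rfl⟩)⟩
  have h1 : ‖∑ i ∈ F, c i • z i‖ = ‖∑ i ∈ F, c i • zz i‖ := by
    rw [← Submodule.norm_coe]; simp [zz]
  have h2 : ‖∑ i ∈ F, c i • w i‖ = ‖T (∑ i ∈ F, c i • zz i)‖ := by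
    rw [← Submodule.norm_coe]
    simp only [map_sum, map_smul, Submodule.coe_sum, Submodule.coe_smul]
    simp only [zz, hT]
  rw [h1, h2]
  constructor
  · refine (T.toContinuousLinearMap.le_opNorm _).trans ?_
    gcongr
    exact le_max_left _ _
  · have h := T.symm.toContinuousLinearMap.le_opNorm (T (∑ i ∈ F, c i • zz i))
    rw [ContinuousLinearEquiv.coe_coe, T.symm_apply_apply] at h
    refine h.trans ?_
    gcongr
    exact le_max_right _ _

end

theorem aux_phi {𝕜 : Type*} [RCLike 𝕜] {X : Type*} [NormedAddCommGroup X] [NormedSpace 𝕜 X]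
    (z : ℕ → X) (hz : z 0 ≠ 0) (φ : ℕ → ℝ)
    (hφ : ∀ n, φ n = sSup {r : ℝ | ∃ (A : Finset ℕ) (ε : ℕ → 𝕜),
        A.card ≤ n ∧ (∀ k ∈ A, ‖ε k‖ = 1) ∧ r = ‖∑ k ∈ A, ε k • z k‖})
    (D : ℕ → ℝ)
    (hD : ∀ (m : ℕ) (A : Finset ℕ), A.card ≤ m → ∀ ε : ℕ → 𝕜, (∀ k ∈ A, ‖ε k‖ = 1) →
        ‖∑ k ∈ A, ε k • z k‖ ≤ D m)
    (hLRP : ∃ b : ℕ, 0 < b ∧ ∀ m : ℕ, 0 < m → 2 * φ m ≤ φ (b * m))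
    (hURP : ∃ b : ℕ, 0 < b ∧ ∀ m : ℕ, 0 < m → φ (b * m) ≤ ((b : ℝ) / 2) * φ m) :
    (∀ m, 0 < m → 0 < φ m) ∧ Monotone φ ∧ (∀ m, φ m ≤ D m) ∧
    (∀ (m : ℕ) (A : Finset ℕ), A.card ≤ m → ‖∑ k ∈ A, z k‖ ≤ φ m) ∧
    ∃ b : ℕ, 2 ≤ b ∧ (∀ m : ℕ, 0 < m → 2 * φ m ≤ φ (b * m)) ∧
      (∀ m : ℕ, 0 < m → φ (b * m) ≤ ((b : ℝ) / 2) * φ m) := by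
  classical
  have hbdd : ∀ n, BddAbove {r : ℝ | ∃ (A : Finset ℕ) (ε : ℕ → 𝕜),
        A.card ≤ n ∧ (∀ k ∈ A, ‖ε k‖ = 1) ∧ r = ‖∑ k ∈ A, ε k • z k‖} := by
    intro n
    refine ⟨D n, ?_⟩
    rintro r ⟨A, ε, hA, hε, rfl⟩
    exact hD n A hA ε hε
  have hmem : ∀ (m : ℕ) (A : Finset ℕ), A.card ≤ m → ∀ ε : ℕ → 𝕜, (∀ k ∈ A, ‖ε k‖ = 1) →
        ‖∑ k ∈ A, ε k • z k‖ ≤ φ m := by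
    intro m A hA ε hε
    rw [hφ]
    exact le_csSup (hbdd m) ⟨A, ε, hA, hε, rfl⟩
  have hle : ∀ (m : ℕ) (M : ℝ), (∀ (A : Finset ℕ), A.card ≤ m → ∀ ε : ℕ → 𝕜, (∀ k ∈ A, ‖ε k‖ = 1) →
        ‖∑ k ∈ A, ε k • z k‖ ≤ M) → φ m ≤ M := by
    intro m M h
    rw [hφ]
    apply csSup_le
    · exact ⟨0, ∅, 0, by simp, by simp, by simp⟩
    · rintro r ⟨A, ε, hA, hε, rfl⟩
      exact h A hA ε hε
  have hone : ∀ (m : ℕ) (A : Finset ℕ), A.card ≤ m → ‖∑ k ∈ A, z k‖ ≤ φ m := by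
    intro m A hA
    simpa using hmem m A hA (fun _ => 1) (by simp)
  have hpos : ∀ m, 0 < m → 0 < φ m := by
    intro m hm
    have h := hone m {0} (by rw [Finset.card_singleton]; exact hm)
    rw [Finset.sum_singleton] at h
    exact (norm_pos_iff.2 hz).trans_le h
  have hmono : Monotone φ := by
    intro m n hmn
    exact hle _ _ fun A hA ε hε => hmem n A (hA.trans hmn) ε hε
  have hadd : ∀ j k, φ (j + k) ≤ φ j + φ k := by
    intro j k
    refine hle _ _ fun A hA ε hε => ?_
    obtain ⟨B, hBA, hB⟩ := Finset.exists_subset_card_eq (s := A) (n := min j A.card) (min_le_right _ _)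
    have hc := Finset.card_sdiff_add_card_eq_card hBA
    rw [← Finset.sum_sdiff hBA, add_comm]
    refine (norm_add_le _ _).trans (add_le_add ?_ ?_)
    · exact hmem j B (by omega) ε fun k hk => hε k (hBA hk)
    · exact hmem k (A \ B) (by omega) ε fun k hk => hε k (Finset.sdiff_subset hk)
  have hzero : φ 0 ≤ 0 := hle _ _ fun A hA ε _ => by
    have : A = ∅ := by simpa using hA
    simp [this]
  have hmul : ∀ n m, φ (n * m) ≤ n * φ m := by
    intro n m
    induction n with
    | zero => simpa using hzero
    | succ n ih =>
      rw [Nat.succ_mul]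
      refine (hadd _ _).trans ?_
      push_cast
      linarith
  refine ⟨hpos, hmono, fun m => hle _ _ fun A hA ε hε => hD m A hA ε hε, hone, ?_⟩
  obtain ⟨b₁, hb₁, h₁⟩ := hLRP
  obtain ⟨b₂, hb₂, h₂⟩ := hURP
  have hL : ∀ m : ℕ, 0 < m → 2 * φ m ≤ φ (b₁ * b₂ * m) := by
    intro m hm
    refine (h₁ m hm).trans (hmono ?_)
    exact Nat.mul_le_mul_right _ (Nat.le_mul_of_pos_right _ hb₂)
  have hU : ∀ m : ℕ, 0 < m → φ (b₁ * b₂ * m) ≤ (((b₁ * b₂ : ℕ) : ℝ) / 2) * φ m := by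
    intro m hm
    rw [mul_assoc]
    refine (hmul _ _).trans ?_
    calc (b₁ : ℝ) * φ (b₂ * m) ≤ b₁ * (((b₂ : ℝ) / 2) * φ m) := by gcongr; exact h₂ m hm
      _ = _ := by push_cast; ring
  refine ⟨b₁ * b₂, ?_, hL, hU⟩
  by_contra hlt
  have h0 := hpos 1 one_pos
  have h3 := (hL 1 one_pos).trans (hU 1 one_pos)
  have h4 : ((b₁ * b₂ : ℕ) : ℝ) ≤ 1 := by exact_mod_cast (show b₁ * b₂ ≤ 1 by omega)
  nlinarith

end

/-- If `𝒳` is a bounded Markushevich basis for `𝕏` with bounded dual system, and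
`𝕏` has a complemented subspace `ℤ` with a subsymmetric (Schauder) basis `𝒵` whose upper
superdemocracy function has both the LRP and the URP, then `𝕏` has a bidemocratic Markushevich
basis `𝒴` with a block basis equivalent to `𝒳`. -/
theorem exists_bidemocratic_basis_with_block_basis
    {𝕜 : Type*} [RCLike 𝕜] {X : Type*} [NormedAddCommGroup X] [NormedSpace 𝕜 X]
    [CompleteSpace X] [TopologicalSpace.SeparableSpace X]
    (hinf : ¬ FiniteDimensional 𝕜 X)
    (x : ℕ → X) (xs : ℕ → X →L[𝕜] 𝕜)
    (hdense : Dense (Submodule.span 𝕜 (Set.range x) : Set X))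
    (hbi : ∀ n k, xs n (x k) = if n = k then 1 else 0)
    (htotal : ∀ f : X, (∀ n, xs n f = 0) → f = 0)
    (hxb : ∃ M : ℝ, ∀ n, ‖x n‖ ≤ M)
    (hxsb : ∃ M : ℝ, ∀ n, ‖xs n‖ ≤ M)
    -- ℤ is a complemented (closed) subspace of 𝕏
    (Z : Submodule 𝕜 X) (hZclosed : IsClosed (Z : Set X))
    (P : X →L[𝕜] X) (hPidem : ∀ v, P (P v) = P v) (hPrange : Set.range P = (Z : Set X))
    -- 𝒵 is a Schauder basis of ℤ …
    (z : ℕ → Z)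
    (hSchauder : ∀ f : Z, ∃! a : ℕ → 𝕜,
      Filter.Tendsto (fun N => ∑ n ∈ Finset.range N, a n • z n) Filter.atTop (nhds f))
    -- … which is unconditional …
    (hUncond : ∀ (f : Z) (a : ℕ → 𝕜),
      Filter.Tendsto (fun N => ∑ n ∈ Finset.range N, a n • z n) Filter.atTop (nhds f) →
      HasSum (fun n => a n • z n) f)
    -- … and equivalent to each of its subsequences (subsymmetric)
    (hSubsymm : ∀ s : ℕ → ℕ, StrictMono s →
      ∃ T : (Submodule.span 𝕜 (Set.range z)).topologicalClosure ≃L[𝕜]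
            (Submodule.span 𝕜 (Set.range (z ∘ s))).topologicalClosure,
        ∀ k, (T ⟨z k, Submodule.le_topologicalClosure _
                (Submodule.subset_span ⟨k, rfl⟩)⟩ : Z) = z (s k))
    -- the upper superdemocracy function of 𝒵 …
    (φ : ℕ → ℝ)
    (hφ : ∀ n, φ n = sSup {r : ℝ | ∃ (A : Finset ℕ) (ε : ℕ → 𝕜),
        A.card ≤ n ∧ (∀ k ∈ A, ‖ε k‖ = 1) ∧ r = ‖∑ k ∈ A, ε k • (z k : X)‖})
    -- … has the LRP and the URP
    (hLRP : ∃ b : ℕ, 0 < b ∧ ∀ m : ℕ, 0 < m → 2 * φ m ≤ φ (b * m))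
    (hURP : ∃ b : ℕ, 0 < b ∧ ∀ m : ℕ, 0 < m → φ (b * m) ≤ ((b : ℝ) / 2) * φ m) :
    ∃ (y : ℕ → X) (ys : ℕ → X →L[𝕜] 𝕜),
      -- 𝒴 is a Markushevich basis for 𝕏 with dual system 𝒴* …
      Dense (Submodule.span 𝕜 (Set.range y) : Set X) ∧
      (∀ n k, ys n (y k) = if n = k then 1 else 0) ∧
      (∀ f : X, (∀ n, ys n f = 0) → f = 0) ∧
      -- … which is bidemocratic …
      (∃ C : ℝ, 1 ≤ C ∧ ∀ (m : ℕ) (A B : Finset ℕ), A.card ≤ m → B.card ≤ m →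
        ‖∑ n ∈ A, y n‖ * ‖∑ n ∈ B, ys n‖ ≤ C * m) ∧
      -- … and has a block basis equivalent to 𝒳
      (∃ (u : ℕ → X) (B : ℕ → Finset ℕ) (a : ℕ → 𝕜),
        (∀ k, (B k).Nonempty) ∧
        (∀ k, ∀ i ∈ B k, ∀ j ∈ B (k + 1), i < j) ∧
        (∀ k, u k = ∑ n ∈ B k, a n • y n) ∧
        ∃ T : (Submodule.span 𝕜 (Set.range u)).topologicalClosure ≃L[𝕜]
              (Submodule.span 𝕜 (Set.range x)).topologicalClosure,
          ∀ k, (T ⟨u k, Submodule.le_topologicalClosure _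
                  (Submodule.subset_span ⟨k, rfl⟩)⟩ : X) = x k) := by
  classical
  obtain ⟨M₁, hM₁⟩ := hxb
  obtain ⟨M₂, hM₂⟩ := hxsb
  have : CompleteSpace Z := hZclosed.completeSpace_coe
  obtain ⟨a, T, R, K, hK, hab, hsum, hRT, hTz, hRz, haR, haT, hphi, hdual⟩ :=
    aux_Z z hSchauder hUncond (fun s hs => by
      obtain ⟨T, hT⟩ := hSubsymm s hs
      exact aux_eqv z (z ∘ s) T hT)
  have hz0 : (z 0 : X) ≠ 0 := by
    intro h
    have h1 : z 0 = 0 := Subtype.ext h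
    have h2 := hab 0 0
    rw [h1, map_zero] at h2
    simp at h2
  obtain ⟨hpos, hmono, hφD, hone, b, hb, hL, hU⟩ := aux_phi (𝕜 := 𝕜) (fun n => (z n : X)) hz0 φ hφ
    (fun m => 4 * K ^ 2 * ‖∑ k ∈ Finset.range m, z k‖)
    (fun m A hA ε hε => by
      have h := hphi m A hA ε hε
      rw [← Submodule.norm_coe] at h
      simpa only [Submodule.coe_sum, Submodule.coe_smul] using h) hLRP hURP
  have hPmem : ∀ f, P f ∈ Z := fun f => by
    have : P f ∈ Set.range P := ⟨f, rfl⟩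
    rwa [hPrange] at this
  let Pz : X →L[𝕜] Z := P.codRestrict Z hPmem
  have hιP : ∀ f, (Pz f : X) = P f := fun f => rfl
  have hPι : ∀ g : Z, Pz (g : X) = g := by
    intro g
    apply Subtype.ext
    rw [hιP]
    have hg : (g : X) ∈ Set.range P := by rw [hPrange]; exact g.2
    obtain ⟨v, hv⟩ := hg
    rw [← hv, hPidem]
  let J : X →L[𝕜] X := ContinuousLinearMap.id 𝕜 X - P + Z.subtypeL.comp (T.comp Pz)
  let L : X →L[𝕜] X := ContinuousLinearMap.id 𝕜 X - P + Z.subtypeL.comp (R.comp Pz)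
  have hJ : ∀ f, J f = f - (Pz f : X) + (T (Pz f) : X) := fun f => rfl
  have hLf : ∀ f, L f = f - (Pz f : X) + (R (Pz f) : X) := fun f => rfl
  have hPJ : ∀ f, Pz (J f) = T (Pz f) := by
    intro f
    rw [hJ, map_add, map_sub, hPι, hPι, sub_self, zero_add]
  have hPL : ∀ f, Pz (L f) = R (Pz f) := by
    intro f
    rw [hLf, map_add, map_sub, hPι, hPι, sub_self, zero_add]
  have hLJ : ∀ f, L (J f) = f := by
    intro f
    rw [hLf, hPJ, hRT, hJ]
    abel
  have hJz : ∀ k, J (z k) = z (2 * k) := by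
    intro k
    rw [hJ, hPι, hTz, sub_self, zero_add]
  have hLw : ∀ k, L (z (2 * k + 1)) = 0 := by
    intro k
    rw [hLf, hPι, hRz, sub_self, zero_add]
    rfl
  let xt : ℕ → X := fun k => J (x k)
  let xts : ℕ → X →L[𝕜] 𝕜 := fun k => (xs k).comp L
  let w : ℕ → X := fun k => z (2 * k + 1)
  let ws : ℕ → X →L[𝕜] 𝕜 := fun k => (a (2 * k + 1)).comp Pz
  have hinj : Function.Injective fun k : ℕ => 2 * k + 1 := fun i j h => by
    simp only at h
    omega
  let C : ℝ := max (max (‖J‖ * M₁) (M₂ * ‖L‖)) (max 1 (8 * K ^ 5 * ‖Pz‖))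
  have hC1 : ‖J‖ * M₁ ≤ C := (le_max_left _ _).trans (le_max_left _ _)
  have hC2 : M₂ * ‖L‖ ≤ C := (le_max_right _ _).trans (le_max_left _ _)
  have hC3 : 1 ≤ C := (le_max_left _ _).trans (le_max_right _ _)
  have hC4 : 8 * K ^ 5 * ‖Pz‖ ≤ C := (le_max_right _ _).trans (le_max_right _ _)
  have hφ0 : ∀ m, 0 ≤ φ m := fun m => (norm_nonneg _).trans (hone m ∅ (by simp))
  have hK0 : 0 ≤ K := by linarith
  obtain ⟨y, ys, h1, h2, h3, h4, B, c, h5, h6, h7⟩ := aux_main φ b hpos hmono hL hU hb xt w xts ws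
    (by
      intro n k
      show xs n (L (J (x k))) = _
      rw [hLJ, hbi])
    (by
      intro n k
      show xs n (L (z (2 * k + 1))) = 0
      rw [hLw, map_zero])
    (by
      intro n k
      show a (2 * n + 1) (Pz (J (x k))) = 0
      rw [hPJ, haT])
    (by
      intro n k
      show a (2 * n + 1) (Pz (z (2 * k + 1))) = _
      rw [hPι, hab]
      by_cases h : n = k
      · simp [h]
      · rw [if_neg h, if_neg (by omega)])
    (by
      let S := (Submodule.span 𝕜 (Set.range xt ∪ Set.range w)).topologicalClosure
      have hScl : IsClosed (S : Set X) := Submodule.isClosed_topologicalClosure _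
      have hsubS : ∀ v ∈ Set.range xt ∪ Set.range w, v ∈ S := fun v hv =>
        Submodule.le_topologicalClosure _ (Submodule.subset_span hv)
      have hJS : ∀ f, J f ∈ S := by
        intro f
        have hcl : IsClosed (J ⁻¹' (S : Set X)) := hScl.preimage J.continuous
        have hsp : (Submodule.span 𝕜 (Set.range x) : Set X) ⊆ J ⁻¹' (S : Set X) := by
          have : Submodule.span 𝕜 (Set.range x) ≤ S.comap (J : X →ₗ[𝕜] X) := by
            rw [Submodule.span_le]
            rintro _ ⟨k, rfl⟩
            exact hsubS _ (Or.inl ⟨k, rfl⟩)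
          exact this
        exact closure_minimal hsp hcl (hdense f)
      have hzS : ∀ n, (z n : X) ∈ S := by
        intro n
        rcases Nat.even_or_odd' n with ⟨k, rfl | rfl⟩
        · rw [← hJz]; exact hJS _
        · exact hsubS _ (Or.inr ⟨k, rfl⟩)
      have hall : ∀ f, f ∈ S := by
        intro f
        have e1 : J (f - (Pz f : X)) = f - (Pz f : X) := by
          rw [hJ, map_sub, hPι, sub_self, map_zero]
          simp
        have e2 : (Pz f : X) ∈ S := by
          have h := Z.subtypeL.hasSum (hsum (Pz f))
          refine hScl.mem_of_tendsto h (Filter.Eventually.of_forall fun F => ?_)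
          refine Submodule.sum_mem _ fun n _ => ?_
          exact Submodule.smul_mem _ _ (hzS n)
        have e3 := hJS (f - (Pz f : X))
        rw [e1] at e3
        simpa using Submodule.add_mem _ e3 e2
      intro f
      exact hall f)
    (by
      intro f hf hg
      have e1 : L f = 0 := htotal _ hf
      have e2 : R (Pz f) = 0 := by rw [← hPL, e1, map_zero]
      have e3 : ∀ n, a n (Pz f) = 0 := by
        intro n
        rcases Nat.even_or_odd' n with ⟨k, rfl | rfl⟩
        · rw [← haR, e2, map_zero]
        · exact hg k
      have e4 : Pz f = 0 := by
        have h := hsum (Pz f)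
        simp only [e3, zero_smul] at h
        exact h.unique hasSum_zero
      rw [hLf, e2, e4] at e1
      simpa using e1)
    C
    (by
      intro n
      refine (J.le_opNorm _).trans (le_trans ?_ hC1)
      gcongr
      exact hM₁ n)
    (by
      intro n
      refine (ContinuousLinearMap.opNorm_comp_le _ _).trans (le_trans ?_ hC2)
      gcongr
      exact hM₂ n)
    (by
      intro m A hA
      have h := hone m (A.map ⟨_, hinj⟩) (by simpa using hA)
      rw [Finset.sum_map] at h
      refine h.trans ?_
      have := hφ0 m
      nlinarith)
    (by
      intro m A hA
      have hb' : ∀ f : X, ‖(∑ n ∈ A, ws n) f‖ * φ m ≤ 8 * K ^ 5 * ‖Pz‖ * m * ‖f‖ := by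
        intro f
        have h := hdual m (A.map ⟨_, hinj⟩) (by simpa using hA) (Pz f)
        rw [Finset.sum_map] at h
        have e : (∑ n ∈ A, ws n) f = ∑ n ∈ A, a (2 * n + 1) (Pz f) := by
          simp [ws, sum_apply]
        rw [e]
        have hle : ‖Pz f‖ ≤ ‖Pz‖ * ‖f‖ := Pz.le_opNorm f
        calc _ ≤ ‖∑ n ∈ A, a (2 * n + 1) (Pz f)‖ * (4 * K ^ 2 * ‖∑ k ∈ Finset.range m, z k‖) := by
              gcongr; exact hφD m
          _ = 4 * K ^ 2 * (‖∑ n ∈ A, a (2 * n + 1) (Pz f)‖ * ‖∑ k ∈ Finset.range m, z k‖) := by ring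
          _ ≤ 4 * K ^ 2 * (2 * K ^ 3 * m * ‖Pz f‖) := mul_le_mul_of_nonneg_left h (by positivity)
          _ ≤ 4 * K ^ 2 * (2 * K ^ 3 * m * (‖Pz‖ * ‖f‖)) := by gcongr
          _ = _ := by ring
      rcases Nat.eq_zero_or_pos m with rfl | hm
      · have : A = ∅ := by simpa using hA
        simp [this]
      · have hp := hpos m hm
        have hn : ‖∑ n ∈ A, ws n‖ ≤ 8 * K ^ 5 * ‖Pz‖ * m / φ m := by
          refine ContinuousLinearMap.opNorm_le_bound _ (by positivity) fun f => ?_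
          have h := hb' f
          rw [div_mul_eq_mul_div, le_div_iff₀ hp]
          exact h
        rw [le_div_iff₀ hp] at hn
        refine hn.trans ?_
        gcongr)
  refine ⟨y, ys, h1, h2, h3, h4, xt, B, c, h5, h6, h7, ?_⟩
  have hLmap : ∀ v ∈ (Submodule.span 𝕜 (Set.range xt)).topologicalClosure,
      L v ∈ (Submodule.span 𝕜 (Set.range x)).topologicalClosure := fun v _ => hdense (L v)
  have hJmap : ∀ v ∈ (Submodule.span 𝕜 (Set.range x)).topologicalClosure,
      J v ∈ (Submodule.span 𝕜 (Set.range xt)).topologicalClosure := by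
    intro v hv
    have hcl : IsClosed (J ⁻¹' ((Submodule.span 𝕜 (Set.range xt)).topologicalClosure : Set X)) :=
      (Submodule.isClosed_topologicalClosure _).preimage J.continuous
    have hsp : (Submodule.span 𝕜 (Set.range x) : Set X) ⊆
        J ⁻¹' ((Submodule.span 𝕜 (Set.range xt)).topologicalClosure : Set X) := by
      have : Submodule.span 𝕜 (Set.range x) ≤
          ((Submodule.span 𝕜 (Set.range xt)).topologicalClosure).comap (J : X →ₗ[𝕜] X) := by
        rw [Submodule.span_le]
        rintro _ ⟨k, rfl⟩
        exact Submodule.le_topologicalClosure _ (Submodule.subset_span ⟨k, rfl⟩)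
      exact this
    exact closure_minimal hsp hcl hv
  have hJL : ∀ v ∈ (Submodule.span 𝕜 (Set.range xt)).topologicalClosure, J (L v) = v := by
    intro v hv
    have hcl : IsClosed {v : X | J (L v) = v} :=
      isClosed_eq (J.continuous.comp L.continuous) continuous_id
    have hsp : (Submodule.span 𝕜 (Set.range xt) : Set X) ⊆ {v : X | J (L v) = v} := by
      intro v hv
      have : Submodule.span 𝕜 (Set.range xt) ≤
          LinearMap.eqLocus ((J.comp L : X →L[𝕜] X) : X →ₗ[𝕜] X) LinearMap.id := by
        rw [Submodule.span_le]
        rintro _ ⟨k, rfl⟩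
        show J (L (J (x k))) = J (x k)
        rw [hLJ]
      exact this hv
    exact closure_minimal hsp hcl hv
  let f₁ : (Submodule.span 𝕜 (Set.range xt)).topologicalClosure →L[𝕜]
      (Submodule.span 𝕜 (Set.range x)).topologicalClosure :=
    (L.comp (Submodule.subtypeL _)).codRestrict _ fun v => hLmap v v.2
  let f₂ : (Submodule.span 𝕜 (Set.range x)).topologicalClosure →L[𝕜]
      (Submodule.span 𝕜 (Set.range xt)).topologicalClosure :=
    (J.comp (Submodule.subtypeL _)).codRestrict _ fun v => hJmap v v.2
  refine ⟨ContinuousLinearEquiv.equivOfInverse f₁ f₂ ?_ ?_, ?_⟩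
  · intro v
    exact Subtype.ext (hJL v v.2)
  · intro v
    exact Subtype.ext (hLJ v)
  · intro k
    exact hLJ (x k)
end

section
/- There exists an infinite-dimensional separable Banach space 𝕏 with a bidemocratic Markushevich basis 𝒳 such that the linear span of the dual system 𝒳* is not a norming subspace of 𝕏*. -/
open scoped ENNReal lp

namespace BidemNN

/-- The weight `1/√(n+1)`. -/
noncomputable def g (n : ℕ) : ℝ := 1 / Real.sqrt ((n : ℝ) + 1)

lemma g_pos (n : ℕ) : 0 < g n := by unfold g; positivity

lemma g_sq (n : ℕ) : g n ^ 2 = 1 / ((n : ℝ) + 1) := by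
  unfold g
  rw [div_pow, Real.sq_sqrt (by positivity)]; simp

lemma sum_range_g (m : ℕ) : ∑ n ∈ Finset.range m, g n ≤ 2 * Real.sqrt m := by
  induction m with
  | zero => simp
  | succ m ih =>
    rw [Finset.sum_range_succ]
    have h1 : (0:ℝ) < Real.sqrt ((m:ℝ) + 1) := by positivity
    have h0 : (0:ℝ) ≤ Real.sqrt (m:ℝ) := by positivity
    have s1 := Real.sq_sqrt (show (0:ℝ) ≤ (m:ℝ) + 1 by positivity)
    have s0 := Real.sq_sqrt (show (0:ℝ) ≤ (m:ℝ) by positivity)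
    have : g m ≤ 2 * Real.sqrt ((m:ℝ)+1) - 2 * Real.sqrt m := by
      unfold g
      rw [div_le_iff₀ h1]
      nlinarith [sq_nonneg (Real.sqrt ((m:ℝ)+1) - Real.sqrt m)]
    push_cast
    linarith

lemma sum_g (m : ℕ) (A : Finset ℕ) (hA : A.card ≤ m) : ∑ n ∈ A, g n ≤ 3 * Real.sqrt m := by
  rw [← Finset.sum_filter_add_sum_filter_not A (fun n => n < m)]
  have h1 : ∑ n ∈ A with n < m, g n ≤ ∑ n ∈ Finset.range m, g n := by
    apply Finset.sum_le_sum_of_subset_of_nonneg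
    · intro n hn
      simp at hn ⊢
      exact hn.2
    · intro i _ _
      exact (g_pos i).le
  have h2 : ∑ n ∈ A with ¬ n < m, g n ≤ Real.sqrt m := by
    rcases Nat.eq_zero_or_pos m with rfl | hm
    · have : A = ∅ := by simpa using hA
      simp [this]
    have hm' : (0:ℝ) < m := by exact_mod_cast hm
    have h3 : ∑ n ∈ A with ¬ n < m, g n ≤ ((A.filter (fun n => ¬ n < m)).card) • (1 / Real.sqrt m) := by
      apply Finset.sum_le_card_nsmul
      intro n hn
      simp at hn
      unfold g
      apply one_div_le_one_div_of_le (by positivity)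
      apply Real.sqrt_le_sqrt
      have : (m:ℝ) ≤ n := by exact_mod_cast hn.2
      linarith
    have h4 : ((A.filter (fun n => ¬ n < m)).card : ℝ) ≤ m := by
      exact_mod_cast (Finset.card_filter_le _ _).trans hA
    rw [nsmul_eq_mul] at h3
    refine h3.trans ?_
    calc _ ≤ (m:ℝ) * (1 / Real.sqrt m) := by gcongr
      _ = Real.sqrt m := by
        rw [mul_one_div, Real.div_sqrt]
  linarith [sum_range_g m]

lemma exists_block (a : ℕ) (R : ℝ) : ∃ b, a < b ∧ R ≤ ∑ n ∈ Finset.Ico a b, g n ^ 2 := by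
  have h := Real.tendsto_sum_range_one_div_nat_succ_atTop
  have h2 := (h.eventually_ge_atTop (R + ∑ n ∈ Finset.range a, g n ^ 2)).and
    (Filter.eventually_gt_atTop a)
  obtain ⟨b, hb, hab⟩ := h2.exists
  refine ⟨b, hab, ?_⟩
  rw [Finset.sum_Ico_eq_sub _ hab.le]
  have : ∑ n ∈ Finset.range b, g n ^ 2 = ∑ i ∈ Finset.range b, (1 / ((i:ℝ) + 1)) :=
    Finset.sum_congr rfl (fun n _ => g_sq n)
  rw [this]
  linarith

/-- The family index of a block. -/
def fam (i : ℕ) : ℕ := (Nat.unpair i).1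

lemma exists_partition : ∃ (j : ℕ → ℕ) (I : ℕ → Finset ℕ), (∀ n i, n ∈ I i ↔ j n = i) ∧
    ∀ i, ((fam i : ℝ) + 1) ^ 2 ≤ ∑ n ∈ I i, g n ^ 2 := by
  choose nx hlt hR using exists_block
  obtain ⟨t, h0, ht⟩ : ∃ t : ℕ → ℕ, t 0 = 0 ∧
      ∀ i, t (i+1) = nx (t i) (((fam i : ℝ) + 1) ^ 2) :=
    ⟨fun i => Nat.rec 0 (fun i a => nx a (((fam i : ℝ) + 1) ^ 2)) i, rfl, fun i => rfl⟩
  have hmono : StrictMono t := strictMono_nat_of_lt_succ (fun i => by rw [ht]; exact hlt _ _)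
  have hex : ∀ n, ∃ i, t i ≤ n ∧ n < t (i+1) := by
    intro n
    have hE : ∃ k, n < t k := ⟨n+1, lt_of_lt_of_le (Nat.lt_succ_self n) (hmono.id_le _)⟩
    classical
    have hs := Nat.find_spec hE
    have hpos : Nat.find hE ≠ 0 := by
      intro h
      rw [h, h0] at hs
      omega
    obtain ⟨k, hk⟩ := Nat.exists_eq_succ_of_ne_zero hpos
    refine ⟨k, ?_, ?_⟩
    · have := Nat.find_min hE (m := k) (by omega)
      omega
    · rw [hk] at hs
      exact hs
  choose j hj1 hj2 using hex
  refine ⟨j, fun i => Finset.Ico (t i) (t (i+1)), ?_, ?_⟩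
  · intro n i
    rw [Finset.mem_Ico]
    constructor
    · rintro ⟨h1, h2⟩
      have a1 := hmono.lt_iff_lt.1 (lt_of_le_of_lt (hj1 n) h2)
      have a2 := hmono.lt_iff_lt.1 (lt_of_le_of_lt h1 (hj2 n))
      omega
    · rintro rfl
      exact ⟨hj1 n, hj2 n⟩
  · intro i
    simp only [ht]
    exact hR _ _

variable (𝕜 : Type) [RCLike 𝕜]

/-- Ambient space `ℓ₂ × ℓ₁ × ℓ₁`. -/
abbrev V : Type := lp (fun _ : ℕ => 𝕜) 2 × lp (fun _ : ℕ => 𝕜) 1 × lp (fun _ : ℕ => 𝕜) 1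

/-- The basis vectors. -/
noncomputable def vec (j : ℕ → ℕ) (n : ℕ) : V 𝕜 :=
  (lp.single 2 n (1:𝕜), lp.single 1 (j n) (((g n / ((fam (j n) : ℝ) + 1) : ℝ)) : 𝕜),
    lp.single 1 (fam (j n)) ((g n : ℝ) : 𝕜))

/-- The space. -/
noncomputable def S (j : ℕ → ℕ) : Submodule 𝕜 (V 𝕜) :=
  (Submodule.span 𝕜 (Set.range (vec 𝕜 j))).topologicalClosure

lemma summable_l1 (f : lp (fun _ : ℕ => 𝕜) 1) : Summable (fun i => ‖f i‖) := by
  have := lp.memℓp f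
  rw [memℓp_gen_iff (by simp)] at this
  simpa using this

lemma norm_l1 (f : lp (fun _ : ℕ => 𝕜) 1) : ‖f‖ = ∑' i, ‖f i‖ := by
  rw [lp.norm_eq_tsum_rpow (by simp)]
  simp

open Classical in
/-- Partial coordinate sum functional on `ℓ₁`. -/
noncomputable def phi (P : Set ℕ) : lp (fun _ : ℕ => 𝕜) 1 →L[𝕜] 𝕜 :=
  LinearMap.mkContinuous
    { toFun := fun f => ∑' i, P.indicator (fun i => f i) i
      map_add' := by
        intro f f'
        have hs : ∀ f : lp (fun _ : ℕ => 𝕜) 1, Summable (P.indicator (fun i => f i)) := fun f =>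
          ((summable_l1 𝕜 f).of_norm).indicator P
        rw [← (hs f).tsum_add (hs f')]
        congr 1
        ext i
        by_cases h : i ∈ P <;> simp [h]
      map_smul' := by
        intro c f
        simp only [RingHom.id_apply, smul_eq_mul]
        rw [← tsum_mul_left]
        congr 1
        ext i
        by_cases h : i ∈ P <;> simp [h] }
    1 (by
      intro f
      rw [one_mul, norm_l1]
      have hs : Summable (fun i => ‖P.indicator (fun i => f i) i‖) := by
        refine Summable.of_nonneg_of_le (fun _ => norm_nonneg _) (fun i => ?_) (summable_l1 𝕜 f)
        by_cases h : i ∈ P <;> simp [h]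
      refine (norm_tsum_le_tsum_norm hs).trans ?_
      refine hs.tsum_le_tsum (fun i => ?_) (summable_l1 𝕜 f)
      by_cases h : i ∈ P <;> simp [h])

lemma phi_single (P : Set ℕ) (i : ℕ) (a : 𝕜) [Decidable (i ∈ P)] :
    phi 𝕜 P (lp.single 1 i a) = if i ∈ P then a else 0 := by
  change ∑' k, P.indicator (fun k => (lp.single (E := fun _ : ℕ => 𝕜) 1 i a : ℕ → 𝕜) k) k = _
  rw [tsum_eq_single i]
  · by_cases h : i ∈ P <;> simp [h]
  · intro k hk
    by_cases h : k ∈ P <;> simp [h, hk]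

lemma phi_zero_iff (f : lp (fun _ : ℕ => 𝕜) 1) (hf : f = 0) (P : Set ℕ) : phi 𝕜 P f = 0 := by
  rw [hf, map_zero]

/-- Coordinate functionals on the ambient space. -/
noncomputable def cA (n : ℕ) : V 𝕜 →L[𝕜] 𝕜 :=
  (lp.evalCLM 𝕜 (fun _ : ℕ => 𝕜) 2 n).comp (ContinuousLinearMap.fst 𝕜 _ _)
noncomputable def cB (n : ℕ) : V 𝕜 →L[𝕜] 𝕜 :=
  (lp.evalCLM 𝕜 (fun _ : ℕ => 𝕜) 1 n).comp
    ((ContinuousLinearMap.fst 𝕜 _ _).comp (ContinuousLinearMap.snd 𝕜 _ _))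
noncomputable def cC (n : ℕ) : V 𝕜 →L[𝕜] 𝕜 :=
  (lp.evalCLM 𝕜 (fun _ : ℕ => 𝕜) 1 n).comp
    ((ContinuousLinearMap.snd 𝕜 _ _).comp (ContinuousLinearMap.snd 𝕜 _ _))

lemma cA_apply (n : ℕ) (v : V 𝕜) : cA 𝕜 n v = v.1 n := rfl
lemma cB_apply (n : ℕ) (v : V 𝕜) : cB 𝕜 n v = v.2.1 n := rfl
lemma cC_apply (n : ℕ) (v : V 𝕜) : cC 𝕜 n v = v.2.2 n := rfl

/-- An identity between continuous functionals passes from the basis vectors to `S`. -/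
lemma eq_on_S (j : ℕ → ℕ) (F G : V 𝕜 →L[𝕜] 𝕜) (h : ∀ n, F (vec 𝕜 j n) = G (vec 𝕜 j n))
    (v : V 𝕜) (hv : v ∈ S 𝕜 j) : F v = G v := by
  have h1 : Submodule.span 𝕜 (Set.range (vec 𝕜 j)) ≤ LinearMap.ker ((F - G : V 𝕜 →L[𝕜] 𝕜) : V 𝕜 →ₗ[𝕜] 𝕜) := by
    rw [Submodule.span_le]
    rintro _ ⟨n, rfl⟩
    simp [h n]
  have h2 := Submodule.topologicalClosure_minimal _ h1 (F - G).isClosed_ker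
  have h3 := h2 hv
  simpa [sub_eq_zero] using h3

lemma total (j : ℕ → ℕ) (I : ℕ → Finset ℕ) (hI : ∀ n i, n ∈ I i ↔ j n = i)
    (v : V 𝕜) (hv : v ∈ S 𝕜 j) (h0 : ∀ n, cA 𝕜 n v = 0) : v = 0 := by
  have hA : v.1 = 0 := by
    ext n
    exact h0 n
  have hB : v.2.1 = 0 := by
    ext i
    have := eq_on_S 𝕜 j (cB 𝕜 i)
      (∑ n ∈ I i, ((g n / ((fam i : ℝ) + 1) : ℝ) : 𝕜) • cA 𝕜 n) ?_ v hv
    · rw [cB_apply] at this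
      rw [this]
      simp [h0]
    · intro n
      simp only [sum_apply, smul_apply, cA_apply, cB_apply,
        vec, lp.single_apply, smul_eq_mul]
      simp only [Pi.single_apply, mul_ite, mul_one, mul_zero, Finset.sum_ite_eq', hI]
      by_cases h : j n = i
      · subst h; simp
      · simp [h, Ne.symm h]
  have hC : v.2.2 = 0 := by
    ext N
    classical
    have := eq_on_S 𝕜 j (cC 𝕜 N)
      (((N : 𝕜) + 1) • ((phi 𝕜 {i | fam i = N}).comp
        ((ContinuousLinearMap.fst 𝕜 _ _).comp (ContinuousLinearMap.snd 𝕜 _ _)))) ?_ v hv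
    · rw [cC_apply] at this
      rw [this]
      simp [hB]
    · intro n
      simp only [smul_apply, cC_apply, ContinuousLinearMap.comp_apply,
        ContinuousLinearMap.coe_fst', ContinuousLinearMap.coe_snd',
        vec, lp.single_apply, smul_eq_mul, phi_single]
      simp only [Pi.single_apply, Set.mem_ofPred_eq]
      by_cases h : fam (j n) = N
      · subst h
        have : ((fam (j n) : 𝕜) + 1) ≠ 0 := by exact_mod_cast Nat.succ_ne_zero (fam (j n))
        simp
        field_simp
      · simp [h, Ne.symm h]
  exact Prod.ext hA (Prod.ext hB hC)

lemma norm_sq_sum (s : Finset ℕ) (f : ℕ → 𝕜) :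
    ‖∑ n ∈ s, lp.single (E := fun _ : ℕ => 𝕜) 2 n (f n)‖ ^ 2 = ∑ n ∈ s, ‖f n‖ ^ 2 := by
  have := lp.norm_sum_single (E := fun _ : ℕ => 𝕜) (p := 2) (by simp) f s
  simpa using this

lemma norm_sum_vec (j : ℕ → ℕ) (m : ℕ) (A : Finset ℕ) (hA : A.card ≤ m) :
    ‖∑ n ∈ A, vec 𝕜 j n‖ ≤ 3 * Real.sqrt m := by
  have hs := sum_g m A hA
  have key : ∀ (w : ℕ → lp (fun _ : ℕ => 𝕜) 1), (∀ n, ‖w n‖ ≤ g n) →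
      ‖∑ n ∈ A, w n‖ ≤ 3 * Real.sqrt m := fun w hw =>
    ((norm_sum_le _ _).trans (Finset.sum_le_sum (fun n _ => hw n))).trans hs
  rw [Prod.norm_def, Prod.norm_def]
  refine max_le ?_ (max_le ?_ ?_)
  · rw [Prod.fst_sum]
    have h := norm_sq_sum 𝕜 A (fun _ => 1)
    simp only [norm_one, one_pow, Finset.sum_const, nsmul_eq_mul, mul_one] at h
    have h1 : ‖∑ n ∈ A, lp.single (E := fun _ : ℕ => 𝕜) 2 n (1:𝕜)‖ ≤ Real.sqrt m := by
      apply Real.le_sqrt_of_sq_le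
      rw [h]
      exact_mod_cast hA
    refine h1.trans ?_
    linarith [Real.sqrt_nonneg (m:ℝ)]
  · rw [Prod.snd_sum, Prod.fst_sum]
    apply key
    intro n
    simp only [vec]
    rw [lp.norm_single (by simp), RCLike.norm_ofReal, abs_of_nonneg (by have := g_pos n; positivity)]
    apply div_le_self (g_pos n).le
    simp
  · rw [Prod.snd_sum, Prod.snd_sum]
    apply key
    intro n
    simp only [vec]
    rw [lp.norm_single (by simp), RCLike.norm_ofReal, abs_of_pos (g_pos n)]

lemma norm_sum_cA (m : ℕ) (B : Finset ℕ) (hB : B.card ≤ m) (v : V 𝕜) :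
    ‖∑ n ∈ B, cA 𝕜 n v‖ ≤ Real.sqrt m * ‖v‖ := by
  have h1 : ∑ n ∈ B, ‖v.1 n‖ ^ 2 ≤ ‖v.1‖ ^ 2 := by
    have := lp.sum_rpow_le_norm_rpow (p := 2) (by simp) v.1 B
    simpa using this
  have h2 : (∑ n ∈ B, ‖v.1 n‖) ^ 2 ≤ B.card * ∑ n ∈ B, ‖v.1 n‖ ^ 2 := sq_sum_le_card_mul_sum_sq
  have h3 : ‖v.1‖ ≤ ‖v‖ := norm_fst_le v
  have h4 : (B.card : ℝ) ≤ m := by exact_mod_cast hB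
  refine (norm_sum_le _ _).trans ?_
  simp only [cA_apply]
  apply le_of_sq_le_sq _ (by positivity)
  rw [mul_pow, Real.sq_sqrt (by positivity)]
  calc _ ≤ _ := h2
    _ ≤ (m:ℝ) * ‖v‖ ^ 2 := by
      gcongr
      exact h1.trans (by gcongr)

/-- The block vectors. -/
noncomputable def blk (j : ℕ → ℕ) (I : ℕ → Finset ℕ) (i : ℕ) : V 𝕜 :=
  ∑ n ∈ I i, (((((fam i : ℝ) + 1) / (∑ n ∈ I i, g n ^ 2)) * g n : ℝ) : 𝕜) • vec 𝕜 j n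

lemma lp_single_sum (s : Finset ℕ) (i : ℕ) (f : ℕ → 𝕜) :
    ∑ n ∈ s, lp.single (E := fun _ : ℕ => 𝕜) 1 i (f n) = lp.single 1 i (∑ n ∈ s, f n) :=
  (map_sum (lp.singleAddMonoidHom (E := fun _ : ℕ => 𝕜) 1 i) f s).symm

lemma blk_mem (j : ℕ → ℕ) (I : ℕ → Finset ℕ)
    (i : ℕ) : blk 𝕜 j I i ∈ S 𝕜 j := by
  apply Submodule.le_topologicalClosure
  exact Submodule.sum_mem _ fun n _ => Submodule.smul_mem _ _ (Submodule.subset_span ⟨n, rfl⟩)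

lemma mass_pos (I : ℕ → Finset ℕ)
    (hm : ∀ i, ((fam i : ℝ) + 1) ^ 2 ≤ ∑ n ∈ I i, g n ^ 2)
    (i : ℕ) : 0 < ∑ n ∈ I i, g n ^ 2 := lt_of_lt_of_le (by positivity) (hm i)

lemma blk_fst (j : ℕ → ℕ) (I : ℕ → Finset ℕ)
    (hm : ∀ i, ((fam i : ℝ) + 1) ^ 2 ≤ ∑ n ∈ I i, g n ^ 2)
    (i : ℕ) : ‖(blk 𝕜 j I i).1‖ ≤ 1 := by
  have hp := mass_pos I hm i
  have e : (blk 𝕜 j I i).1 = ∑ n ∈ I i, lp.single (E := fun _ : ℕ => 𝕜) 2 n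
      (((((fam i : ℝ) + 1) / (∑ n ∈ I i, g n ^ 2)) * g n : ℝ) : 𝕜) := by
    rw [blk, Prod.fst_sum]
    refine Finset.sum_congr rfl fun n _ => ?_
    rw [Prod.smul_fst, vec, ← lp.single_smul, smul_eq_mul, mul_one]
  have h := norm_sq_sum 𝕜 (I i)
    (fun n => (((((fam i : ℝ) + 1) / (∑ n ∈ I i, g n ^ 2)) * g n : ℝ) : 𝕜))
  rw [← e] at h
  simp only [RCLike.norm_ofReal, sq_abs, mul_pow] at h
  rw [← Finset.mul_sum] at h
  have : ‖(blk 𝕜 j I i).1‖ ^ 2 ≤ 1 := by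
    rw [h, div_pow, div_mul_eq_mul_div, div_le_one (by positivity), sq (∑ n ∈ I i, g n ^ 2)]
    exact mul_le_mul_of_nonneg_right (hm i) hp.le
  exact (sq_le_one_iff₀ (norm_nonneg _)).1 this

lemma blk_snd_fst (j : ℕ → ℕ) (I : ℕ → Finset ℕ)
    (hI : ∀ n i, n ∈ I i ↔ j n = i)
    (hm : ∀ i, ((fam i : ℝ) + 1) ^ 2 ≤ ∑ n ∈ I i, g n ^ 2)
    (i : ℕ) : (blk 𝕜 j I i).2.1 = lp.single 1 i (1:𝕜) := by
  have hp := mass_pos I hm i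
  rw [blk, Prod.snd_sum, Prod.fst_sum]
  have : ∀ n ∈ I i, ((((((fam i : ℝ) + 1) / (∑ n ∈ I i, g n ^ 2)) * g n : ℝ) : 𝕜) • vec 𝕜 j n).2.1
      = lp.single (E := fun _ : ℕ => 𝕜) 1 i ((g n ^ 2 / (∑ n ∈ I i, g n ^ 2) : ℝ) : 𝕜) := by
    intro n hn
    have hj := (hI n i).1 hn
    rw [Prod.smul_snd, Prod.smul_fst, vec, hj, ← lp.single_smul, smul_eq_mul, ← RCLike.ofReal_mul]
    congr 2
    have : ((fam i : ℝ) + 1) ≠ 0 := by positivity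
    field_simp
  rw [Finset.sum_congr rfl this, lp_single_sum, ← RCLike.ofReal_sum, ← Finset.sum_div,
    div_self hp.ne', RCLike.ofReal_one]

lemma blk_snd_snd (j : ℕ → ℕ) (I : ℕ → Finset ℕ)
    (hI : ∀ n i, n ∈ I i ↔ j n = i)
    (hm : ∀ i, ((fam i : ℝ) + 1) ^ 2 ≤ ∑ n ∈ I i, g n ^ 2)
    (i : ℕ) : (blk 𝕜 j I i).2.2 = lp.single 1 (fam i) (((fam i : ℝ) + 1 : ℝ) : 𝕜) := by
  have hp := mass_pos I hm i
  rw [blk, Prod.snd_sum, Prod.snd_sum]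
  have : ∀ n ∈ I i, ((((((fam i : ℝ) + 1) / (∑ n ∈ I i, g n ^ 2)) * g n : ℝ) : 𝕜) • vec 𝕜 j n).2.2
      = lp.single (E := fun _ : ℕ => 𝕜) 1 (fam i)
        ((((fam i : ℝ) + 1) * g n ^ 2 / (∑ n ∈ I i, g n ^ 2) : ℝ) : 𝕜) := by
    intro n hn
    have hj := (hI n i).1 hn
    rw [Prod.smul_snd, Prod.smul_snd, vec, hj, ← lp.single_smul, smul_eq_mul, ← RCLike.ofReal_mul]
    congr 2
    ring
  rw [Finset.sum_congr rfl this, lp_single_sum, ← RCLike.ofReal_sum, ← Finset.sum_div,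
    ← Finset.mul_sum, mul_div_assoc, div_self hp.ne', mul_one]

lemma blk_large (j : ℕ → ℕ) (I : ℕ → Finset ℕ)
    (hI : ∀ n i, n ∈ I i ↔ j n = i)
    (hm : ∀ i, ((fam i : ℝ) + 1) ^ 2 ≤ ∑ n ∈ I i, g n ^ 2)
    (i : ℕ) : (fam i : ℝ) + 1 ≤ ‖blk 𝕜 j I i‖ := by
  have h1 : ‖(blk 𝕜 j I i).2.2‖ = (fam i : ℝ) + 1 := by
    rw [blk_snd_snd 𝕜 j I hI hm, lp.norm_single (by simp), RCLike.norm_ofReal,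
      abs_of_pos (by positivity)]
  rw [← h1]
  exact (norm_snd_le _).trans (norm_snd_le _)

lemma blk_sub (j : ℕ → ℕ) (I : ℕ → Finset ℕ)
    (hI : ∀ n i, n ∈ I i ↔ j n = i)
    (hm : ∀ i, ((fam i : ℝ) + 1) ^ 2 ≤ ∑ n ∈ I i, g n ^ 2)
    (i i' : ℕ) (h : fam i = fam i') : ‖blk 𝕜 j I i - blk 𝕜 j I i'‖ ≤ 2 := by
  rw [Prod.norm_def, Prod.norm_def]
  refine max_le ?_ (max_le ?_ ?_)
  · rw [Prod.fst_sub]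
    refine (norm_sub_le _ _).trans ?_
    linarith [blk_fst 𝕜 j I hm i, blk_fst 𝕜 j I hm i']
  · rw [Prod.snd_sub, Prod.fst_sub]
    refine (norm_sub_le _ _).trans ?_
    rw [blk_snd_fst 𝕜 j I hI hm, blk_snd_fst 𝕜 j I hI hm, lp.norm_single (by simp),
      lp.norm_single (by simp)]
    norm_num
  · rw [Prod.snd_sub, Prod.snd_sub, blk_snd_snd 𝕜 j I hI hm, blk_snd_snd 𝕜 j I hI hm, h, sub_self,
      norm_zero]
    norm_num

lemma cA_blk (j : ℕ → ℕ) (I : ℕ → Finset ℕ)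
    (hI : ∀ n i, n ∈ I i ↔ j n = i)
    (n i : ℕ) (h : j n ≠ i) : cA 𝕜 n (blk 𝕜 j I i) = 0 := by
  rw [blk, map_sum]
  refine Finset.sum_eq_zero fun k hk => ?_
  have hne : n ≠ k := by
    rintro rfl
    exact h ((hI _ _).1 hk)
  rw [map_smul, cA_apply, vec]
  simp [hne]

end BidemNN

open BidemNN in

/-- There is an infinite-dimensional separable Banach space `𝕏` with a
bidemocratic Markushevich basis `𝒳` whose dual system spans a non-norming subspace of `𝕏*`. -/
theorem exists_bidemocratic_basis_with_non_norming_dual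
    (𝕜 : Type) [RCLike 𝕜] :
    ∃ (X : Type) (_ : NormedAddCommGroup X) (_ : NormedSpace 𝕜 X),
      CompleteSpace X ∧ TopologicalSpace.SeparableSpace X ∧ ¬ FiniteDimensional 𝕜 X ∧
      ∃ (x : ℕ → X) (xs : ℕ → X →L[𝕜] 𝕜),
        -- 𝒳 is a Markushevich basis
        Dense (Submodule.span 𝕜 (Set.range x) : Set X) ∧
        (∀ n k, xs n (x k) = if n = k then 1 else 0) ∧
        (∀ f : X, (∀ n, xs n f = 0) → f = 0) ∧
        -- 𝒳 is bidemocratic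
        (∃ C : ℝ, 1 ≤ C ∧ ∀ (m : ℕ) (A B : Finset ℕ), A.card ≤ m → B.card ≤ m →
          ‖∑ n ∈ A, x n‖ * ‖∑ n ∈ B, xs n‖ ≤ C * m) ∧
        -- ⟨𝒳*⟩ is not norming
        ¬ ∃ c : ℝ, 0 < c ∧ c ≤ 1 ∧ ∀ f : X, c * ‖f‖ ≤
          sSup {r : ℝ | ∃ g ∈ Submodule.span 𝕜 (Set.range xs), ‖g‖ ≤ 1 ∧ r = ‖g f‖} := by
  obtain ⟨j, I, hI, hm⟩ := exists_partition
  have hcA : ∀ n k, cA 𝕜 n (vec 𝕜 j k) = if n = k then 1 else 0 := by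
    intro n k
    rw [cA_apply, vec]
    simp [Pi.single_apply]
  have hcl : (S 𝕜 j : Set (V 𝕜)) = closure (Submodule.span 𝕜 (Set.range (vec 𝕜 j))) := rfl
  have hmem : ∀ n, vec 𝕜 j n ∈ S 𝕜 j := fun n =>
    Submodule.le_topologicalClosure _ (Submodule.subset_span ⟨n, rfl⟩)
  let x : ℕ → S 𝕜 j := fun n => ⟨vec 𝕜 j n, hmem n⟩
  let xs : ℕ → S 𝕜 j →L[𝕜] 𝕜 := fun n => (cA 𝕜 n).comp (S 𝕜 j).subtypeL
  have hbi : ∀ n k, xs n (x k) = if n = k then 1 else 0 := hcA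
  have hsum : ∀ (B : Finset ℕ) (f : S 𝕜 j), (∑ n ∈ B, xs n) f = ∑ n ∈ B, cA 𝕜 n (f : V 𝕜) := by
    intro B f
    simp [xs]
  refine ⟨S 𝕜 j, inferInstance, inferInstance, ?_, ?_, ?_, x, xs, ?_, hbi, ?_, ?_, ?_⟩
  · exact (Submodule.isClosed_topologicalClosure _).completeSpace_coe
  · have h1 : TopologicalSpace.IsSeparable (S 𝕜 j : Set (V 𝕜)) := by
      rw [hcl]
      exact ((Set.countable_range _).isSeparable.span).closure
    exact h1.separableSpace
  · intro hfd
    have hli : LinearIndependent 𝕜 x := by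
      rw [linearIndependent_iff']
      intro s c hc n hn
      have := congrArg (xs n) hc
      rw [map_sum, map_zero] at this
      simpa [hbi, hn] using this
    exact not_finite_iff_infinite.2 inferInstance hli.finite
  · intro v
    rw [Metric.mem_closure_iff]
    intro ε hε
    have hv : (v : V 𝕜) ∈ closure (Submodule.span 𝕜 (Set.range (vec 𝕜 j)) : Set (V 𝕜)) := v.2
    obtain ⟨w, hw, hd⟩ := Metric.mem_closure_iff.1 hv ε hε
    have hle : Submodule.span 𝕜 (Set.range (vec 𝕜 j)) ≤
        (Submodule.span 𝕜 (Set.range x)).map (S 𝕜 j).subtype := by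
      rw [Submodule.span_le]
      rintro _ ⟨n, rfl⟩
      exact ⟨x n, Submodule.subset_span ⟨n, rfl⟩, rfl⟩
    obtain ⟨u, hu, rfl⟩ := hle hw
    exact ⟨u, hu, hd⟩
  · intro f hf
    exact Subtype.ext (total 𝕜 j I hI f f.2 hf)
  · refine ⟨3, by norm_num, fun m A B hA hB => ?_⟩
    have h1 : ‖∑ n ∈ A, x n‖ ≤ 3 * Real.sqrt m := by
      have := norm_sum_vec 𝕜 j m A hA
      have e : ((∑ n ∈ A, x n : S 𝕜 j) : V 𝕜) = ∑ n ∈ A, vec 𝕜 j n := by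
        rw [Submodule.coe_sum]
      rw [← e] at this
      exact this
    have h2 : ‖∑ n ∈ B, xs n‖ ≤ Real.sqrt m := by
      refine ContinuousLinearMap.opNorm_le_bound _ (Real.sqrt_nonneg _) fun f => ?_
      rw [hsum]
      exact norm_sum_cA 𝕜 m B hB f
    calc _ ≤ (3 * Real.sqrt m) * Real.sqrt m := by gcongr
      _ = 3 * m := by rw [mul_assoc, Real.mul_self_sqrt (by positivity)]
  · rintro ⟨c, hc, -, h⟩
    obtain ⟨N, hN⟩ := exists_nat_gt (2 / c)
    let f : S 𝕜 j := ⟨blk 𝕜 j I (Nat.pair N 0), blk_mem 𝕜 j I _⟩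
    have hf1 : (N : ℝ) + 1 ≤ ‖f‖ := by
      have := blk_large 𝕜 j I hI hm (Nat.pair N 0)
      simp only [fam, Nat.unpair_pair] at this
      exact this
    have hf2 : sSup {r : ℝ | ∃ g ∈ Submodule.span 𝕜 (Set.range xs), ‖g‖ ≤ 1 ∧ r = ‖g f‖} ≤ 2 := by
      apply Real.sSup_le _ (by norm_num)
      rintro r ⟨φ, hφ, hφ1, rfl⟩
      have hev : ∃ K : ℕ, ∀ k, K ≤ k →
          φ ⟨blk 𝕜 j I (Nat.pair N k), blk_mem 𝕜 j I _⟩ = 0 := by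
        clear hφ1
        induction hφ using Submodule.span_induction with
        | mem y hy =>
          obtain ⟨n, rfl⟩ := hy
          refine ⟨j n + 1, fun k hk => cA_blk 𝕜 j I hI _ _ ?_⟩
          have := Nat.right_le_pair N k
          omega
        | zero => exact ⟨0, fun k _ => rfl⟩
        | add y z _ _ hy hz =>
          obtain ⟨K, hK⟩ := hy
          obtain ⟨L, hL⟩ := hz
          refine ⟨max K L, fun k hk => ?_⟩
          rw [add_apply, hK k (le_of_max_le_left hk),
            hL k (le_of_max_le_right hk), add_zero]
        | smul a y _ hy =>
          obtain ⟨K, hK⟩ := hy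
          refine ⟨K, fun k hk => ?_⟩
          rw [smul_apply, hK k hk, smul_zero]
      obtain ⟨K, hK⟩ := hev
      let z : S 𝕜 j := ⟨blk 𝕜 j I (Nat.pair N K), blk_mem 𝕜 j I _⟩
      have hz : φ z = 0 := hK K le_rfl
      have hd : ‖f - z‖ ≤ 2 :=
        blk_sub 𝕜 j I hI hm (Nat.pair N 0) (Nat.pair N K) (by simp [fam])
      have e : φ f = φ (f - z) := by rw [map_sub, hz, sub_zero]
      rw [e]
      calc _ ≤ ‖φ‖ * ‖f - z‖ := φ.le_opNorm _
        _ ≤ 1 * 2 := by gcongr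
        _ = 2 := by norm_num
    have h3 := (h f).trans hf2
    rw [div_lt_iff₀ hc] at hN
    nlinarith [mul_le_mul_of_nonneg_left hf1 hc.le]
end
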